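/- arXiv:2006.10293 — 7 statements merged into one kernel-verified Lean document; each statement's English description precedes it below -/
import Mathlib

section
/- Let d, k be positive natural numbers, let A be a symmetric d×d real matrix with largest eigenvalue λ_max(A), let b_1,…,b_{2k} ∈ ℝ^d and c_1,…,c_{2k} ∈ ℝ, and define the softmax-quadratic discriminator D(x) = (1/2)⟨x, A x⟩ + log(∑_{i=1}^{k} exp(⟨b_i, x⟩ + c_i)) − log(∑_{i=k+1}^{2k} exp(⟨b_i, x⟩ + c_i)) for x ∈ ℝ^d. Then for every x, v ∈ ℝ^d, the real function t ↦ D(x + t·v) is twice differentiable and its second derivative at t = 0 is at most (λ_max(A) + 2·max_{1≤i≤2k} ‖b_i‖²)·‖v‖². -/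
open MeasureTheory
open scoped RealInnerProductSpace

/-- The derivative of `t ↦ ∑ i, w i * exp (β i * t + α i)`. -/
lemma hasDerivAt_sum_mul_exp {ι : Type*} [Fintype ι] (w α β : ι → ℝ) (t : ℝ) :
    HasDerivAt (fun t => ∑ i, w i * Real.exp (β i * t + α i))
      (∑ i, w i * β i * Real.exp (β i * t + α i)) t := by
  refine HasDerivAt.fun_sum fun i _ => ?_
  have h := ((((hasDerivAt_id t).const_mul (β i)).add_const (α i)).exp).const_mul (w i)
  refine h.congr_deriv ?_
  simp only [id]
  ring

/-- The log-sum-exp of finitely many affine functions of one variable is twice differentiable,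
with nonnegative second derivative bounded by the largest squared slope. -/
lemma exists_hasDerivAt_log_sum_exp {ι : Type*} [Fintype ι] [Nonempty ι] (α β : ι → ℝ) :
    ∃ f' f'' : ℝ → ℝ,
      (∀ t, HasDerivAt (fun t => Real.log (∑ i, Real.exp (β i * t + α i))) (f' t) t) ∧
      (∀ t, HasDerivAt f' (f'' t) t) ∧ (∀ t, 0 ≤ f'' t) ∧
      ∀ B, (∀ i, β i ^ 2 ≤ B) → ∀ t, f'' t ≤ B := by
  set e : ℝ → ι → ℝ := fun t i => Real.exp (β i * t + α i) with he
  have epos : ∀ t i, 0 < e t i := fun t i => Real.exp_pos _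
  have hpos : ∀ t, 0 < ∑ i, e t i := fun t =>
    Finset.sum_pos (fun i _ => epos t i) Finset.univ_nonempty
  have h0 : ∀ t, HasDerivAt (fun t => ∑ i, e t i) (∑ i, β i * e t i) t := fun t => by
    simpa using hasDerivAt_sum_mul_exp (fun _ => 1) α β t
  have h1 : ∀ t, HasDerivAt (fun t => ∑ i, β i * e t i) (∑ i, β i * β i * e t i) t := fun t =>
    hasDerivAt_sum_mul_exp β α β t
  refine ⟨fun t => (∑ i, β i * e t i) / ∑ i, e t i, _, fun t => (h0 t).log (hpos t).ne',
    fun t => (h1 t).fun_div (h0 t) (hpos t).ne', fun t => ?_, fun B hB t => ?_⟩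
  · refine div_nonneg ?_ (sq_nonneg _)
    have h := Finset.sum_sq_le_sum_mul_sum_of_sq_le_mul Finset.univ (r := fun i => β i * e t i)
      (f := fun i => β i * β i * e t i) (g := e t)
      (fun i _ => mul_nonneg (mul_self_nonneg _) (epos t i).le) (fun i _ => (epos t i).le)
      (fun i _ => le_of_eq (by ring))
    nlinarith [h]
  · have h : ∑ i, β i * β i * e t i ≤ B * ∑ i, e t i := by
      rw [Finset.mul_sum]
      refine Finset.sum_le_sum fun i _ => mul_le_mul_of_nonneg_right ?_ (epos t i).le
      rw [← sq]
      exact hB i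
    rw [div_le_iff₀ (pow_pos (hpos t) 2)]
    nlinarith [mul_le_mul_of_nonneg_right h (hpos t).le, sq_nonneg (∑ i, β i * e t i)]

/-- The quadratic form of a symmetric matrix is bounded by its largest eigenvalue. -/
lemma Matrix.IsHermitian.inner_toEuclideanLin_le {n : Type*} [Fintype n] [DecidableEq n]
    {A : Matrix n n ℝ} (hA : A.IsHermitian) (v : EuclideanSpace ℝ n) :
    ⟪v, Matrix.toEuclideanLin A v⟫ ≤ (⨆ i, hA.eigenvalues i) * ‖v‖ ^ 2 := by
  have hs := Matrix.isSymmetric_toEuclideanLin_iff.mpr hA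
  have he : ∀ i, Matrix.toEuclideanLin A (hA.eigenvectorBasis i) =
      hA.eigenvalues i • hA.eigenvectorBasis i := fun i => by
    ext j
    simpa using congrFun (hA.mulVec_eigenvectorBasis i) j
  rw [← real_inner_self_eq_norm_sq, ← hA.eigenvectorBasis.sum_inner_mul_inner v v,
    ← hA.eigenvectorBasis.sum_inner_mul_inner v (Matrix.toEuclideanLin A v), Finset.mul_sum]
  refine Finset.sum_le_sum fun i _ => ?_
  rw [← hs, he, real_inner_smul_left, real_inner_comm v (hA.eigenvectorBasis i)]
  have := le_ciSup (Set.finite_range hA.eigenvalues).bddAbove i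
  nlinarith [mul_self_nonneg ⟪v, hA.eigenvectorBasis i⟫]

/-- For the softmax-quadratic discriminator
`D(x) = ½⟨x, Ax⟩ + log ∑_{i<k} exp(⟨b_i,x⟩+c_i) − log ∑_{k≤i<2k} exp(⟨b_i,x⟩+c_i)`
with `A` symmetric, the map `t ↦ D(x + t•v)` is twice differentiable and its second
derivative at `0` is at most `(λ_max(A) + 2·max_i ‖b_i‖²)·‖v‖²`. -/
theorem stmt0 (d k : ℕ) (hd : 0 < d) (hk : 0 < k)
    (A : Matrix (Fin d) (Fin d) ℝ) (hA : A.IsHermitian)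
    (b : Fin (2 * k) → EuclideanSpace ℝ (Fin d)) (c : Fin (2 * k) → ℝ)
    (D : EuclideanSpace ℝ (Fin d) → ℝ)
    (hD : D = fun x =>
      (1 / 2) * ⟪x, Matrix.toEuclideanLin A x⟫ +
        Real.log (∑ i : Fin k, Real.exp
          (⟪b (Fin.castLE (by omega) i), x⟫ + c (Fin.castLE (by omega) i))) -
        Real.log (∑ i : Fin k, Real.exp
          (⟪b ⟨k + i, by have := i.isLt; omega⟩, x⟫ + c ⟨k + i, by have := i.isLt; omega⟩)))
    (x v : EuclideanSpace ℝ (Fin d)) :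
    Differentiable ℝ (fun t : ℝ => D (x + t • v)) ∧
    Differentiable ℝ (deriv fun t : ℝ => D (x + t • v)) ∧
    iteratedDeriv 2 (fun t : ℝ => D (x + t • v)) 0 ≤
      ((⨆ i, hA.eigenvalues i) + 2 * ⨆ i, ‖b i‖ ^ 2) * ‖v‖ ^ 2 := by
  have : Nonempty (Fin k) := ⟨⟨0, hk⟩⟩
  set M : ℝ := ⨆ i, ‖b i‖ ^ 2 with hM
  have hb : ∀ i, ⟪b i, v⟫ ^ 2 ≤ M * ‖v‖ ^ 2 := fun i => by
    have h1 := le_ciSup (Set.finite_range fun i => ‖b i‖ ^ 2).bddAbove i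
    have h2 : ⟪b i, v⟫ ^ 2 ≤ (‖b i‖ * ‖v‖) ^ 2 :=
      sq_le_sq' (neg_le_of_abs_le (abs_real_inner_le_norm _ _)) (real_inner_le_norm _ _)
    rw [mul_pow] at h2
    exact h2.trans (mul_le_mul_of_nonneg_right h1 (sq_nonneg _))
  have hM0 : 0 ≤ M := Real.iSup_nonneg fun i => sq_nonneg _
  obtain ⟨f', f'', hf, hf', -, hfB⟩ := exists_hasDerivAt_log_sum_exp
    (fun i : Fin k => ⟪b (Fin.castLE (by omega) i), x⟫ + c (Fin.castLE (by omega) i))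
    (fun i : Fin k => ⟪b (Fin.castLE (by omega) i), v⟫)
  obtain ⟨g', g'', hg, hg', hg0, -⟩ := exists_hasDerivAt_log_sum_exp
    (fun i : Fin k => ⟪b ⟨k + i, by have := i.isLt; omega⟩, x⟫ +
      c ⟨k + i, by have := i.isLt; omega⟩)
    (fun i : Fin k => ⟪b ⟨k + i, by have := i.isLt; omega⟩, v⟫)
  set a := ⟪v, Matrix.toEuclideanLin A v⟫ with ha
  set q := (⟪x, Matrix.toEuclideanLin A v⟫ + ⟪v, Matrix.toEuclideanLin A x⟫) / 2 with hq
  have hlin : ∀ t : ℝ, HasDerivAt (fun t : ℝ => q + t * a) a t := fun t => by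
    simpa using ((hasDerivAt_id t).mul_const a).const_add q
  have hquad : ∀ t : ℝ, HasDerivAt
      (fun t : ℝ => (1 / 2) * ⟪x + t • v, Matrix.toEuclideanLin A (x + t • v)⟫)
      (q + t * a) t := fun t => by
    have h := ((((hasDerivAt_id t).mul_const q).const_add
      ((1 / 2) * ⟪x, Matrix.toEuclideanLin A x⟫)).fun_add
      (((hasDerivAt_id t).pow 2).mul_const (a / 2)))
    refine (h.congr_deriv ?_).congr_of_eventuallyEq (.of_forall fun s => ?_)
    · simp
      ring
    · simp only [map_add, map_smul, inner_add_left, inner_add_right, real_inner_smul_left,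
        real_inner_smul_right, hq, ha, id, Pi.pow_apply]
      ring
  have hD1 : ∀ t, HasDerivAt (fun t : ℝ => D (x + t • v)) (q + t * a + f' t - g' t) t :=
    fun t => by
    refine (((hquad t).fun_add (hf t)).fun_sub (hg t)).congr_of_eventuallyEq
      (.of_forall fun s => ?_)
    have hc : ∀ u : EuclideanSpace ℝ (Fin d), ∀ r : ℝ,
        ⟪u, x + s • v⟫ + r = ⟪u, v⟫ * s + (⟪u, x⟫ + r) := fun u r => by
      rw [inner_add_right, real_inner_smul_right]
      ring
    simp only [hD, hc]
  have hderiv : (deriv fun t : ℝ => D (x + t • v)) = fun t => q + t * a + f' t - g' t :=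
    funext fun t => (hD1 t).deriv
  have hD2 : ∀ t, HasDerivAt (deriv fun t : ℝ => D (x + t • v)) (a + f'' t - g'' t) t :=
    fun t => hderiv ▸ ((hlin t).fun_add (hf' t)).fun_sub (hg' t)
  refine ⟨fun t => (hD1 t).differentiableAt, fun t => (hD2 t).differentiableAt, ?_⟩
  rw [iteratedDeriv_succ, iteratedDeriv_one, (hD2 0).deriv]
  have h1 := hA.inner_toEuclideanLin_le v
  have h2 := hfB (M * ‖v‖ ^ 2) (fun i => hb _) 0
  have h3 := hg0 0
  have h4 := mul_nonneg hM0 (sq_nonneg ‖v‖)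
  linarith
end

section
/- Let d be a positive natural number, η < 1 a real number, and f : ℝ^d → ℝ a twice continuously differentiable function such that for every x, u ∈ ℝ^d the second derivative at t = 0 of the function t ↦ f(x + t·u) is at most η·‖u‖². Then for every x, u ∈ ℝ^d, f(x + u) − (1/2)‖u‖² ≤ f(x) + ‖∇f(x)‖² / (2(1 − η)), where ∇f(x) denotes the gradient of f at x. -/
open MeasureTheory

/-- A `C²` function whose second derivative is bounded above by `c` satisfies the second order
Taylor upper bound at `1`. -/
theorem le_taylor_of_iteratedDeriv_two_le {g : ℝ → ℝ} {c : ℝ} (hg : ContDiff ℝ 2 g)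
    (hc : ∀ s, iteratedDeriv 2 g s ≤ c) : g 1 ≤ g 0 + deriv g 0 + c / 2 := by
  have hg0 : Differentiable ℝ g := hg.differentiable (by norm_num)
  have hg1 : Differentiable ℝ (deriv g) := by
    simpa [iteratedDeriv_one] using hg.differentiable_iteratedDeriv 1 (by norm_num)
  have hk : Antitone fun t => deriv g t - c * t := by
    have hd : ∀ t, HasDerivAt (fun t => deriv g t - c * t) (deriv (deriv g) t - c) t := fun t => by
      have h := (hg1 t).hasDerivAt.sub ((hasDerivAt_id t).const_mul c)
      rw [mul_one] at h
      exact h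
    refine antitone_of_deriv_nonpos (fun t => (hd t).differentiableAt) fun t => ?_
    have := hc t
    rw [iteratedDeriv_succ, iteratedDeriv_one] at this
    rw [(hd t).deriv]
    linarith
  have hd : ∀ t, HasDerivAt (fun t => g t - deriv g 0 * t - c / 2 * t ^ 2)
      (deriv g t - deriv g 0 - c * t) t := fun t => by
    have h := ((hg0 t).hasDerivAt.sub ((hasDerivAt_id t).const_mul (deriv g 0))).sub
      ((hasDerivAt_pow 2 t).const_mul (c / 2))
    refine HasDerivAt.congr_deriv h ?_
    norm_num
    ring
  have hm : AntitoneOn (fun t => g t - deriv g 0 * t - c / 2 * t ^ 2) (Set.Ici 0) := by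
    refine antitoneOn_of_deriv_nonpos (convex_Ici 0)
      (fun t _ => (hd t).continuousAt.continuousWithinAt)
      (fun t _ => (hd t).differentiableAt.differentiableWithinAt) fun t ht => ?_
    rw [interior_Ici] at ht
    have := hk (le_of_lt ht)
    rw [(hd t).deriv]
    simp only [mul_zero, sub_zero] at this
    linarith
  have := hm (Set.mem_Ici.2 le_rfl) (Set.mem_Ici.2 zero_le_one) zero_le_one
  norm_num at this
  linarith

/-- If `f : ℝ^d → ℝ` is twice continuously differentiable and all its
directional second derivatives satisfy `d²/dt² f(x + tu)|₀ ≤ η‖u‖²` with `η < 1`, then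
`f(x + u) − ½‖u‖² ≤ f(x) + ‖∇f(x)‖²/(2(1 − η))` for all `x, u`. -/
theorem stmt2 (d : ℕ) (hd : 0 < d) (η : ℝ) (hη : η < 1)
    (f : EuclideanSpace ℝ (Fin d) → ℝ) (hf : ContDiff ℝ 2 f)
    (hsecond : ∀ x u : EuclideanSpace ℝ (Fin d),
      iteratedDeriv 2 (fun t : ℝ => f (x + t • u)) 0 ≤ η * ‖u‖ ^ 2) :
    ∀ x u : EuclideanSpace ℝ (Fin d),
      f (x + u) - (1 / 2) * ‖u‖ ^ 2 ≤ f x + ‖gradient f x‖ ^ 2 / (2 * (1 - η)) := by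
  intro x u
  have hg : ContDiff ℝ 2 (fun t : ℝ => f (x + t • u)) := by fun_prop
  have hc : ∀ s, iteratedDeriv 2 (fun t : ℝ => f (x + t • u)) s ≤ η * ‖u‖ ^ 2 := fun s => by
    have h := hsecond (x + s • u) u
    have e : (fun t : ℝ => f (x + s • u + t • u)) =
        fun t => (fun t : ℝ => f (x + t • u)) (s + t) := by
      funext t
      simp only [add_smul, add_assoc]
    have e' := congrFun (iteratedDeriv_comp_const_add 2 (fun t : ℝ => f (x + t • u)) s) 0
    rw [e, e', add_zero] at h
    exact h
  have hT := le_taylor_of_iteratedDeriv_two_le hg hc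
  have hderiv : deriv (fun t : ℝ => f (x + t • u)) 0 = inner ℝ (gradient f x) u := by
    have hfx : DifferentiableAt ℝ f x := hf.differentiable (by norm_num) x
    have h : HasDerivAt (fun t : ℝ => f (x + t • u)) (fderiv ℝ f x u) 0 :=
      hfx.hasFDerivAt.hasLineDerivAt u
    rw [h.deriv, gradient, InnerProductSpace.toDual_symm_apply]
  have hCS := real_inner_le_norm (gradient f x) u
  have hη' : 0 < 1 - η := by linarith
  have hY : ‖gradient f x‖ * ‖u‖ - (1 - η) / 2 * ‖u‖ ^ 2 ≤
      ‖gradient f x‖ ^ 2 / (2 * (1 - η)) := by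
    rw [le_div_iff₀ (by positivity)]
    nlinarith [sq_nonneg (‖gradient f x‖ - (1 - η) * ‖u‖)]
  simp only [one_smul, zero_smul, add_zero] at hT
  rw [hderiv] at hT
  linarith
end

section
/- Let d, k be positive natural numbers, A a symmetric d×d real matrix, b_1,…,b_{2k} ∈ ℝ^d with ‖b_i‖ ≤ 1 for all i, c_1,…,c_{2k} ∈ ℝ, d_1,…,d_k ∈ ℝ^d with ‖d_i‖ ≤ 1 for all i, and e_1,…,e_k ∈ ℝ. Define D(x) = (1/2)⟨x, A x⟩ + log(∑_{i=1}^{k} exp(⟨b_i, x⟩ + c_i)) − log(∑_{i=k+1}^{2k} exp(⟨b_i, x⟩ + c_i)). Then for every x ∈ ℝ^d, D is differentiable at x and ‖∇D(x)‖² ≤ 3k²(1 + ‖x‖)²·( ‖A‖² + ∑_{i=1}^{k} [ ‖b_i − d_i‖² + ‖b_{k+i} − d_i‖² + (c_i − e_i)² + (c_{k+i} − e_i)² ] ), where ‖A‖ denotes the operator norm of A. -/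
open MeasureTheory
open scoped RealInnerProductSpace

section Softmax

variable {ι E : Type*} [Fintype ι] [NormedAddCommGroup E] [InnerProductSpace ℝ E]

/-- The softmax weights of a finite family of scores. -/
noncomputable def softmaxWeight (a : ι → ℝ) (i : ι) : ℝ :=
  Real.exp (a i) / ∑ j, Real.exp (a j)

lemma sum_exp_pos [Nonempty ι] (a : ι → ℝ) : 0 < ∑ j, Real.exp (a j) :=
  Finset.sum_pos (fun _ _ => Real.exp_pos _) Finset.univ_nonempty

lemma softmaxWeight_pos [Nonempty ι] (a : ι → ℝ) (i : ι) : 0 < softmaxWeight a i :=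
  div_pos (Real.exp_pos _) (sum_exp_pos a)

lemma sum_softmaxWeight [Nonempty ι] (a : ι → ℝ) : ∑ i, softmaxWeight a i = 1 := by
  simp only [softmaxWeight]
  rw [← Finset.sum_div, div_self (sum_exp_pos a).ne']

lemma log_softmaxWeight [Nonempty ι] (a : ι → ℝ) (i : ι) :
    Real.log (softmaxWeight a i) = a i - Real.log (∑ j, Real.exp (a j)) := by
  rw [softmaxWeight, Real.log_div (Real.exp_ne_zero _) (sum_exp_pos a).ne', Real.log_exp]

lemma two_mul_sub_sq_div_add_le_sub_mul_log_sub_log {p q : ℝ} (hp : 0 < p) (hq : 0 < q) :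
    2 * ((p - q) ^ 2 / (p + q)) ≤ (p - q) * (Real.log p - Real.log q) := by
  wlog h : q ≤ p generalizing p q
  · have := this hq hp (le_of_not_ge h)
    rw [add_comm q p, sub_sq_comm] at this
    linarith
  have hx : 0 ≤ p / q - 1 := by
    rw [sub_nonneg, le_div_iff₀ hq]
    linarith
  have key := Real.le_log_one_add_of_nonneg hx
  rw [add_sub_cancel, Real.log_div hp.ne' hq.ne'] at key
  have heq : 2 * ((p - q) ^ 2 / (p + q)) = (p - q) * (2 * (p / q - 1) / (p / q - 1 + 2)) := by
    have : p / q - 1 + 2 = (p + q) / q := by field_simp; ring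
    rw [this]
    field_simp
  rw [heq]
  exact mul_le_mul_of_nonneg_left key (sub_nonneg.2 h)

/-- A symmetrized form of Pinsker's inequality. -/
lemma sq_sum_abs_sub_le_sum_sub_mul_log_sub_log {p q : ι → ℝ} (hp : ∀ i, 0 < p i)
    (hq : ∀ i, 0 < q i) (hp1 : ∑ i, p i = 1) (hq1 : ∑ i, q i = 1) :
    (∑ i, |p i - q i|) ^ 2 ≤ ∑ i, (p i - q i) * (Real.log (p i) - Real.log (q i)) := by
  have h := Finset.sq_sum_div_le_sum_sq_div Finset.univ (fun i => |p i - q i|)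
    (g := fun i => p i + q i) (fun i _ => add_pos (hp i) (hq i))
  simp only [sq_abs] at h
  rw [Finset.sum_add_distrib, hp1, hq1] at h
  have h2 := Finset.sum_le_sum fun i (_ : i ∈ Finset.univ) =>
    two_mul_sub_sq_div_add_le_sub_mul_log_sub_log (hp i) (hq i)
  rw [← Finset.mul_sum] at h2
  linarith

/-- Softmax is `1`-Lipschitz from the sup norm to the `ℓ¹` norm. -/
lemma sum_abs_softmaxWeight_sub_le [Nonempty ι] {a a' : ι → ℝ} {s : ℝ}
    (h : ∀ i, |a i - a' i| ≤ s) :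
    ∑ i, |softmaxWeight a i - softmaxWeight a' i| ≤ s := by
  set p := softmaxWeight a
  set q := softmaxWeight a'
  have hpin := sq_sum_abs_sub_le_sum_sub_mul_log_sub_log (softmaxWeight_pos a)
    (softmaxWeight_pos a') (sum_softmaxWeight a) (sum_softmaxWeight a')
  have hlog : ∑ i, (p i - q i) * (Real.log (p i) - Real.log (q i))
      = ∑ i, (p i - q i) * (a i - a' i) := by
    have hconst : ∑ i, (p i - q i) *
        (Real.log (∑ j, Real.exp (a' j)) - Real.log (∑ j, Real.exp (a j))) = 0 := by
      rw [← Finset.sum_mul, Finset.sum_sub_distrib, sum_softmaxWeight, sum_softmaxWeight]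
      simp
    rw [← add_zero (∑ i, (p i - q i) * (a i - a' i)), ← hconst, ← Finset.sum_add_distrib]
    refine Finset.sum_congr rfl fun i _ => ?_
    rw [log_softmaxWeight, log_softmaxWeight]
    ring
  have hle : ∑ i, (p i - q i) * (a i - a' i) ≤ (∑ i, |p i - q i|) * s := by
    rw [Finset.sum_mul]
    refine Finset.sum_le_sum fun i _ => (le_abs_self _).trans ?_
    rw [abs_mul]
    exact mul_le_mul_of_nonneg_left (h i) (abs_nonneg _)
  have hnonneg : 0 ≤ ∑ i, |p i - q i| := Finset.sum_nonneg fun i _ => abs_nonneg _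
  rcases hnonneg.eq_or_lt with h0 | h0
  · rw [← h0]
    exact (abs_nonneg _).trans (h (Classical.arbitrary ι))
  · refine le_of_mul_le_mul_left ?_ h0
    calc _ = (∑ i, |p i - q i|) ^ 2 := (sq _).symm
      _ ≤ _ := hpin.trans (hlog.le.trans hle)

lemma norm_sum_softmaxWeight_smul_sub_le [Nonempty ι] {a a' : ι → ℝ} {b b' : ι → E} {m : ℝ}
    (hb' : ∀ i, ‖b' i‖ ≤ 1) (hm : ∀ i, ‖b i - b' i‖ ≤ m) :
    ‖∑ i, softmaxWeight a i • b i - ∑ i, softmaxWeight a' i • b' i‖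
      ≤ m + ∑ i, |softmaxWeight a i - softmaxWeight a' i| := by
  have hm' : m = ∑ i, softmaxWeight a i * m := by
    rw [← Finset.sum_mul, sum_softmaxWeight, one_mul]
  rw [hm', ← Finset.sum_sub_distrib, ← Finset.sum_add_distrib]
  refine norm_sum_le_of_le _ fun i _ => ?_
  have : softmaxWeight a i • b i - softmaxWeight a' i • b' i
      = softmaxWeight a i • (b i - b' i) + (softmaxWeight a i - softmaxWeight a' i) • b' i := by
    module
  rw [this]
  refine (norm_add_le _ _).trans (add_le_add ?_ ?_)
  · rw [norm_smul, Real.norm_of_nonneg (softmaxWeight_pos a i).le]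
    exact mul_le_mul_of_nonneg_left (hm i) (softmaxWeight_pos a i).le
  · rw [norm_smul, Real.norm_eq_abs]
    exact mul_le_of_le_one_right (abs_nonneg _) (hb' i)

lemma hasGradientAt_log_sum_exp [CompleteSpace E] [Nonempty ι] (b : ι → E) (c : ι → ℝ) (x : E) :
    HasGradientAt (fun y => Real.log (∑ i, Real.exp (⟪b i, y⟫ + c i)))
      (∑ i, softmaxWeight (fun j => ⟪b j, x⟫ + c j) i • b i) x := by
  have h : ∀ i ∈ Finset.univ, HasFDerivAt (fun y => Real.exp (⟪b i, y⟫ + c i))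
      (Real.exp (⟪b i, x⟫ + c i) • innerSL ℝ (b i)) x := fun i _ =>
    ((innerSL ℝ (b i)).hasFDerivAt.add_const (c i)).exp
  have h' := (HasFDerivAt.fun_sum h).log (sum_exp_pos fun i => ⟪b i, x⟫ + c i).ne'
  rw [hasGradientAt_iff_hasFDerivAt]
  refine h'.congr_fderiv ?_
  ext y
  simp [softmaxWeight, Finset.mul_sum, div_eq_inv_mul, mul_assoc]

lemma hasGradientAt_half_inner_apply [CompleteSpace E] {T : E →L[ℝ] E}
    (hT : (T : E →ₗ[ℝ] E).IsSymmetric) (x : E) :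
    HasGradientAt (fun y => (1 / 2) * ⟪y, T y⟫) (T x) x := by
  rw [hasGradientAt_iff_hasFDerivAt]
  refine (((hasFDerivAt_id x).inner ℝ T.hasFDerivAt).const_mul (1 / 2)).congr_fderiv ?_
  ext y
  have h1 : ⟪x, T y⟫ = ⟪T x, y⟫ := (hT x y).symm
  have h2 : ⟪y, T x⟫ = ⟪T x, y⟫ := real_inner_comm _ _
  simp [h1, h2]
  ring

lemma HasGradientAt.add_sub [CompleteSpace E] {f g h : E → ℝ} {f' g' h' x : E}
    (hf : HasGradientAt f f' x) (hg : HasGradientAt g g' x) (hh : HasGradientAt h h' x) :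
    HasGradientAt (fun y => f y + g y - h y) (f' + g' - h') x := by
  rw [hasGradientAt_iff_hasFDerivAt] at *
  simpa using (hf.fun_add hg).fun_sub hh

lemma norm_sub_sq_add_sub_sq_le (u v w : E) (p q r : ℝ) :
    ‖u - v‖ ^ 2 + (p - q) ^ 2 ≤
      2 * (‖u - w‖ ^ 2 + ‖v - w‖ ^ 2 + (p - r) ^ 2 + (q - r) ^ 2) := by
  have h := parallelogram_law_with_norm ℝ (u - w) (v - w)
  rw [sub_sub_sub_cancel_right] at h
  nlinarith [sq_nonneg (p - r + (q - r)), mul_self_nonneg ‖u - w + (v - w)‖]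

/-- The bound on the gradient of a quadratic form plus a difference of two log-sum-exps, in terms
of a bound `t` on the squared distance of the two families of parameters. -/
lemma norm_sq_apply_add_softmax_sub_le [Nonempty ι] (T : E →L[ℝ] E) (x : E) {b b' : ι → E}
    {c c' : ι → ℝ} {t : ℝ} (hb' : ∀ i, ‖b' i‖ ≤ 1)
    (ht : ∀ i, ‖b i - b' i‖ ^ 2 + (c i - c' i) ^ 2 ≤ 2 * t) :
    ‖T x + ∑ i, softmaxWeight (fun j => ⟪b j, x⟫ + c j) i • b i
        - ∑ i, softmaxWeight (fun j => ⟪b' j, x⟫ + c' j) i • b' i‖ ^ 2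
      ≤ 3 * (Fintype.card ι : ℝ) ^ 2 * (1 + ‖x‖) ^ 2 * (‖T‖ ^ 2 + t) := by
  set r := ‖x‖
  have hr : 0 ≤ r := norm_nonneg x
  have ht0 : 0 ≤ 2 * t := (by positivity : (0 : ℝ) ≤ _).trans (ht (Classical.arbitrary ι))
  set m := √(2 * t)
  have hm0 : 0 ≤ m := Real.sqrt_nonneg _
  have hmsq : m ^ 2 = 2 * t := Real.sq_sqrt ht0
  have hδ : ∀ i, ‖b i - b' i‖ ≤ m := fun i =>
    Real.le_sqrt_of_sq_le (by nlinarith [ht i, sq_nonneg (c i - c' i)])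
  have hγ : ∀ i, |c i - c' i| ≤ m := fun i =>
    Real.abs_le_sqrt (by nlinarith [ht i, sq_nonneg ‖b i - b' i‖])
  have hT : ‖T x‖ ≤ (1 + r) * ‖T‖ := by
    nlinarith [T.le_opNorm x, norm_nonneg T]
  have hsm := norm_sum_softmaxWeight_smul_sub_le (a := fun j => ⟪b j, x⟫ + c j)
    (a' := fun j => ⟪b' j, x⟫ + c' j) hb' hδ
  have htri : ∀ u v : E, ‖T x + u - v‖ ≤ ‖T x‖ + ‖u - v‖ := fun u v => by
    rw [add_sub_assoc]
    exact norm_add_le _ _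
  have hmr : m ≤ (1 + r) * m := by nlinarith
  have hS : 0 ≤ (1 + r) ^ 2 * (‖T‖ ^ 2 + t) := by
    have : 0 ≤ t := by linarith
    positivity
  rcases subsingleton_or_nontrivial ι with hι | hι
  · have hw : ∀ (a : ι → ℝ) (i : ι), softmaxWeight a i = 1 := fun a i => by
      rw [← sum_softmaxWeight a, Fintype.sum_subsingleton _ i]
    simp only [hw, sub_self, abs_zero, Finset.sum_const_zero, add_zero] at hsm ⊢
    have hcard : Fintype.card ι = 1 :=
      le_antisymm (Fintype.card_le_one_iff_subsingleton.2 hι) Fintype.card_pos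
    rw [hcard]
    calc _ ≤ ((1 + r) * (‖T‖ + m)) ^ 2 :=
          pow_le_pow_left₀ (norm_nonneg _) ((htri _ _).trans (by linarith)) 2
      _ = (1 + r) ^ 2 * (‖T‖ + m) ^ 2 := mul_pow _ _ _
      _ ≤ (1 + r) ^ 2 * (3 * (‖T‖ ^ 2 + t)) := by
          gcongr
          nlinarith [sq_nonneg (2 * ‖T‖ - m)]
      _ = _ := by push_cast; ring
  · have hs : ∀ i, |(⟪b i, x⟫ + c i) - (⟪b' i, x⟫ + c' i)| ≤ (1 + r) * m := fun i => by
      have h1 : (⟪b i, x⟫ + c i) - (⟪b' i, x⟫ + c' i) = ⟪b i - b' i, x⟫ + (c i - c' i) := by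
        rw [inner_sub_left]
        ring
      rw [h1]
      have h2 : |⟪b i - b' i, x⟫| ≤ m * r :=
        (abs_real_inner_le_norm _ _).trans (mul_le_mul_of_nonneg_right (hδ i) hr)
      linarith [abs_add_le ⟪b i - b' i, x⟫ (c i - c' i), hγ i]
    have hL := sum_abs_softmaxWeight_sub_le hs
    have hcard : (2 : ℝ) ≤ Fintype.card ι := by
      exact_mod_cast Fintype.one_lt_card (α := ι)
    calc _ ≤ ((1 + r) * (‖T‖ + 2 * m)) ^ 2 :=
          pow_le_pow_left₀ (norm_nonneg _) ((htri _ _).trans (by linarith)) 2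
      _ = (1 + r) ^ 2 * (‖T‖ + 2 * m) ^ 2 := mul_pow _ _ _
      _ ≤ (1 + r) ^ 2 * (3 * 2 ^ 2 * (‖T‖ ^ 2 + t)) := by
          gcongr
          nlinarith [sq_nonneg (4 * ‖T‖ - m)]
      _ = 3 * 2 ^ 2 * ((1 + r) ^ 2 * (‖T‖ ^ 2 + t)) := by ring
      _ ≤ 3 * (Fintype.card ι : ℝ) ^ 2 * ((1 + r) ^ 2 * (‖T‖ ^ 2 + t)) := by gcongr
      _ = _ := by ring

end Softmax

/-- For the softmax-quadratic discriminator with `‖bᵢ‖ ≤ 1`, `‖dᵢ‖ ≤ 1`,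
`D` is differentiable everywhere and
`‖∇D(x)‖² ≤ 3k²(1+‖x‖)²(‖A‖² + ∑ᵢ [‖bᵢ−dᵢ‖² + ‖b_{k+i}−dᵢ‖² + (cᵢ−eᵢ)² + (c_{k+i}−eᵢ)²])`,
where `‖A‖` is the operator norm. -/
theorem stmt3 (d k : ℕ) (hd : 0 < d) (hk : 0 < k)
    (A : Matrix (Fin d) (Fin d) ℝ) (hA : A.IsHermitian)
    (b : Fin (2 * k) → EuclideanSpace ℝ (Fin d)) (hb : ∀ i, ‖b i‖ ≤ 1)
    (c : Fin (2 * k) → ℝ)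
    (dvec : Fin k → EuclideanSpace ℝ (Fin d)) (hdvec : ∀ i, ‖dvec i‖ ≤ 1)
    (e : Fin k → ℝ)
    (D : EuclideanSpace ℝ (Fin d) → ℝ)
    (hD : D = fun x =>
      (1 / 2) * ⟪x, Matrix.toEuclideanLin A x⟫ +
        Real.log (∑ i : Fin k, Real.exp
          (⟪b (Fin.castLE (by omega) i), x⟫ + c (Fin.castLE (by omega) i))) -
        Real.log (∑ i : Fin k, Real.exp
          (⟪b ⟨k + i, by have := i.isLt; omega⟩, x⟫ + c ⟨k + i, by have := i.isLt; omega⟩)))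
    (x : EuclideanSpace ℝ (Fin d)) :
    DifferentiableAt ℝ D x ∧
    ‖gradient D x‖ ^ 2 ≤ 3 * (k : ℝ) ^ 2 * (1 + ‖x‖) ^ 2 *
      (‖Matrix.toEuclideanCLM (𝕜 := ℝ) A‖ ^ 2 +
        ∑ i : Fin k,
          (‖b (Fin.castLE (by omega) i) - dvec i‖ ^ 2 +
            ‖b ⟨k + i, by have := i.isLt; omega⟩ - dvec i‖ ^ 2 +
            (c (Fin.castLE (by omega) i) - e i) ^ 2 +
            (c ⟨k + i, by have := i.isLt; omega⟩ - e i) ^ 2)) := by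
  have : Nonempty (Fin k) := ⟨⟨0, hk⟩⟩
  have hsymm : ((Matrix.toEuclideanCLM (𝕜 := ℝ) A : EuclideanSpace ℝ (Fin d) →L[ℝ] _) :
      EuclideanSpace ℝ (Fin d) →ₗ[ℝ] _).IsSymmetric := by
    rw [Matrix.coe_toEuclideanCLM_eq_toEuclideanLin]
    exact Matrix.isSymmetric_toEuclideanLin_iff.2 hA
  have hgrad := (hasGradientAt_half_inner_apply hsymm x).add_sub
    (hasGradientAt_log_sum_exp (fun i : Fin k => b (Fin.castLE (by omega) i))
      (fun i => c (Fin.castLE (by omega) i)) x)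
    (hasGradientAt_log_sum_exp (fun i : Fin k => b ⟨k + i, by have := i.isLt; omega⟩)
      (fun i => c ⟨k + i, by have := i.isLt; omega⟩) x)
  replace hgrad := hgrad.congr_of_eventuallyEq (Filter.EventuallyEq.of_eq hD)
  refine ⟨hgrad.differentiableAt, ?_⟩
  rw [hgrad.gradient]
  have hbound := norm_sq_apply_add_softmax_sub_le (Matrix.toEuclideanCLM (𝕜 := ℝ) A) x
    (b := fun i : Fin k => b (Fin.castLE (by omega) i))
    (b' := fun i : Fin k => b ⟨k + i, by have := i.isLt; omega⟩)
    (c := fun i : Fin k => c (Fin.castLE (by omega) i))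
    (c' := fun i : Fin k => c ⟨k + i, by have := i.isLt; omega⟩)
    (t := ∑ i : Fin k,
          (‖b (Fin.castLE (by omega) i) - dvec i‖ ^ 2 +
            ‖b ⟨k + i, by have := i.isLt; omega⟩ - dvec i‖ ^ 2 +
            (c (Fin.castLE (by omega) i) - e i) ^ 2 +
            (c ⟨k + i, by have := i.isLt; omega⟩ - e i) ^ 2))
    (fun i => hb _) (fun i => (norm_sub_sq_add_sub_sq_le _ _ (dvec i) _ _ (e i)).trans
      (mul_le_mul_of_nonneg_left
        (Finset.single_le_sum (f := fun i : Fin k =>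
          ‖b (Fin.castLE (by omega) i) - dvec i‖ ^ 2 +
            ‖b ⟨k + i, by have := i.isLt; omega⟩ - dvec i‖ ^ 2 +
            (c (Fin.castLE (by omega) i) - e i) ^ 2 +
            (c ⟨k + i, by have := i.isLt; omega⟩ - e i) ^ 2)
          (fun j _ => by positivity) (Finset.mem_univ i)) zero_le_two))
  rwa [Fintype.card_fin] at hbound
end

section
/- Let m ∈ ℝ and v > 0, and let μ = gaussianReal m v be the Gaussian measure on ℝ with mean m and variance v. Then m·(∫ tanh(x) dμ(x)) − m²·(∫ (1 − tanh(x)²) dμ(x)) ≥ 0, and equality holds if and only if m = 0. -/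
open MeasureTheory ProbabilityTheory

theorem Real.hasDerivAt_tanh' (x : ℝ) : HasDerivAt Real.tanh (1 - Real.tanh x ^ 2) x := by
  have hc := (Real.cosh_pos x).ne'
  have h := (Real.hasDerivAt_sinh x).div (Real.hasDerivAt_cosh x) hc
  have e : Real.tanh = Real.sinh / Real.cosh := funext Real.tanh_eq_sinh_div_cosh
  rw [e]
  refine h.congr_deriv ?_
  simp only [Pi.div_apply]
  field_simp

theorem integral_gaussianReal_eq_integral_add (g : ℝ → ℝ) (m : ℝ) (v : NNReal) :
    ∫ x, g x ∂(gaussianReal m v) = ∫ y, g (y + m) ∂(gaussianReal 0 v) := by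
  have h := gaussianReal_map_add_const (μ := 0) (v := v) m
  rw [zero_add] at h
  rw [← h]
  exact (measurableEmbedding_addRight m).integral_map g

theorem integral_gaussianReal_neg (g : ℝ → ℝ) (m : ℝ) (v : NNReal) :
    ∫ x, g x ∂(gaussianReal (-m) v) = ∫ x, g (-x) ∂(gaussianReal m v) := by
  rw [← gaussianReal_map_neg]
  exact (MeasurableEquiv.neg ℝ).measurableEmbedding.integral_map g

theorem Continuous.integrable_gaussianReal {g : ℝ → ℝ} (hg : Continuous g) {C : ℝ}
    (hC : ∀ x, |g x| ≤ C) (m : ℝ) (v : NNReal) : Integrable g (gaussianReal m v) :=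
  .of_bound hg.aestronglyMeasurable C (.of_forall hC)

/-- Differentiation of a Gaussian expectation with respect to the mean. -/
theorem hasDerivAt_integral_gaussianReal {g g' : ℝ → ℝ} (hg : ∀ x, HasDerivAt g (g' x) x)
    (hg' : Continuous g') {C C' : ℝ} (hC : ∀ x, |g x| ≤ C) (hC' : ∀ x, |g' x| ≤ C')
    (v : NNReal) (m : ℝ) :
    HasDerivAt (fun m => ∫ x, g x ∂(gaussianReal m v)) (∫ x, g' x ∂(gaussianReal m v)) m := by
  have hgc : Continuous g := continuous_iff_continuousAt.2 fun x => (hg x).continuousAt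
  rw [funext fun t => integral_gaussianReal_eq_integral_add g t v,
    integral_gaussianReal_eq_integral_add g' m v]
  refine (hasDerivAt_integral_of_dominated_loc_of_deriv_le (F := fun m y => g (y + m))
    (F' := fun m y => g' (y + m)) (bound := fun _ => C') Filter.univ_mem
    (.of_forall fun t => (by fun_prop : Continuous fun y => g (y + t)).aestronglyMeasurable)
    ((by fun_prop : Continuous fun y => g (y + m)).integrable_gaussianReal (fun _ => hC _) 0 v)
    (by fun_prop : Continuous fun y => g' (y + m)).aestronglyMeasurable
    (.of_forall fun y t _ => hC' _) (integrable_const _)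
    (.of_forall fun y t _ => (hg (y + t)).comp_const_add y t)).2

theorem gaussianPDFReal_neg_lt {m x : ℝ} {v : NNReal} (hv : 0 < v) (h : 0 < m * x) :
    gaussianPDFReal (-m) v x < gaussianPDFReal m v x := by
  have hv' : (0 : ℝ) < v := hv
  unfold gaussianPDFReal
  have hsq : (x - m) ^ 2 < (x - -m) ^ 2 := by nlinarith
  have hexp : -(x - -m) ^ 2 / (2 * v) < -(x - m) ^ 2 / (2 * v) := by gcongr
  exact mul_lt_mul_of_pos_left (Real.exp_lt_exp.2 hexp) (by positivity)

/-- A bounded odd function that is positive on the positive half-line has positive expectation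
under a Gaussian measure with positive mean. -/
theorem integral_gaussianReal_pos_of_odd {h : ℝ → ℝ} (hc : Continuous h) (hodd : h.Odd) {C : ℝ}
    (hC : ∀ x, |h x| ≤ C) (hpos : ∀ x, 0 < x → 0 < h x) {m : ℝ} (hm : 0 < m) {v : NNReal}
    (hv : 0 < v) : 0 < ∫ x, h x ∂(gaussianReal m v) := by
  have hneg : ∫ x, h x ∂(gaussianReal (-m) v) = -∫ x, h x ∂(gaussianReal m v) := by
    simp only [integral_gaussianReal_neg, hodd _, integral_neg]
  have hint (t : ℝ) : Integrable (fun x => gaussianPDFReal t v x • h x) :=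
    (integrable_gaussianPDFReal t v).mul_bdd hc.aestronglyMeasurable (.of_forall hC)
  have hpt (x : ℝ) (hx : x ≠ 0) :
      0 < gaussianPDFReal m v x • h x - gaussianPDFReal (-m) v x • h x := by
    rw [← sub_smul, smul_eq_mul]
    rcases hx.lt_or_gt with hx | hx
    · have h1 := hpos (-x) (by linarith)
      rw [hodd] at h1
      have h2 := gaussianPDFReal_neg_lt (m := -m) (x := x) hv (by nlinarith)
      rw [neg_neg] at h2
      nlinarith
    · exact mul_pos (sub_pos.2 (gaussianPDFReal_neg_lt hv (by positivity))) (hpos x hx)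
  have key : 0 < ∫ x, (gaussianPDFReal m v x • h x - gaussianPDFReal (-m) v x • h x) := by
    refine (integral_pos_iff_support_of_nonneg ?_ ((hint m).sub (hint (-m)))).2 ?_
    rotate_left
    · refine lt_of_lt_of_le ?_ (measure_mono (s := Set.Ioi (0 : ℝ)) fun x hx => (hpt x hx.ne').ne')
      simp
    · intro x
      by_cases hx : x = 0
      · subst hx
        have : h 0 = 0 := by have := hodd 0; rw [neg_zero] at this; linarith
        simp [this]
      · exact (hpt x hx).le
  rw [integral_sub (hint m) (hint (-m)), ← integral_gaussianReal_eq_integral_smul hv.ne',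
    ← integral_gaussianReal_eq_integral_smul hv.ne', hneg] at key
  linarith

theorem integral_tanh_gaussianReal_gt {m : ℝ} (hm : 0 < m) {v : NNReal} (hv : 0 < v) :
    m * ∫ x, (1 - Real.tanh x ^ 2) ∂(gaussianReal m v) < ∫ x, Real.tanh x ∂(gaussianReal m v) := by
  have hcont : Continuous Real.tanh :=
    continuous_iff_continuousAt.2 fun x => (Real.hasDerivAt_tanh' x).continuousAt
  have hb (x : ℝ) : |Real.tanh x| ≤ 1 := (Real.abs_tanh_lt_one x).le
  have hb' (x : ℝ) : |1 - Real.tanh x ^ 2| ≤ 1 := by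
    rw [abs_le]; constructor <;> nlinarith [Real.tanh_sq_lt_one x, sq_nonneg (Real.tanh x)]
  have hodd : Function.Odd fun x => 2 * Real.tanh x * (1 - Real.tanh x ^ 2) := fun x => by
    simp only [Real.tanh_neg]; ring
  have hb'' (x : ℝ) : |2 * Real.tanh x * (1 - Real.tanh x ^ 2)| ≤ 2 := by
    rw [abs_mul, abs_mul, abs_two]
    nlinarith [hb x, hb' x, abs_nonneg (Real.tanh x), abs_nonneg (1 - Real.tanh x ^ 2)]
  have hd1 := hasDerivAt_integral_gaussianReal Real.hasDerivAt_tanh' (by fun_prop) hb hb' v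
  have hd2 := hasDerivAt_integral_gaussianReal (g := fun x => 1 - Real.tanh x ^ 2)
    (g' := fun x => -(2 * Real.tanh x * (1 - Real.tanh x ^ 2)))
    (fun x => (((Real.hasDerivAt_tanh' x).pow 2).const_sub 1).congr_deriv (by simp))
    (by fun_prop) hb' (C' := 2) (fun x => by rw [abs_neg]; exact hb'' x) v
  have hanti : StrictAntiOn (fun m => ∫ x, (1 - Real.tanh x ^ 2) ∂(gaussianReal m v))
      (Set.Ici 0) := by
    refine strictAntiOn_of_deriv_neg (convex_Ici 0)
      (fun t _ => (hd2 t).continuousAt.continuousWithinAt) fun t ht => ?_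
    rw [interior_Ici] at ht
    rw [(hd2 t).deriv, integral_neg, neg_lt_zero]
    refine integral_gaussianReal_pos_of_odd (by fun_prop) hodd hb'' (fun x hx => ?_) ht hv
    have h1 : 0 < Real.tanh x := by
      rw [Real.tanh_eq_sinh_div_cosh]
      exact div_pos (Real.sinh_pos_iff.2 hx) (Real.cosh_pos x)
    have h2 := Real.tanh_sq_lt_one x
    exact mul_pos (by positivity) (by linarith)
  obtain ⟨c, ⟨hc0, hcm⟩, hc⟩ := exists_hasDerivAt_eq_slope _ _ hm
    (fun t _ => (hd1 t).continuousAt.continuousWithinAt) fun t _ => hd1 t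
  have h0 : ∫ x, Real.tanh x ∂(gaussianReal 0 v) = 0 := by
    have h := integral_gaussianReal_neg Real.tanh 0 v
    simp only [neg_zero, Real.tanh_neg, integral_neg] at h
    linarith
  rw [h0, sub_zero, sub_zero, eq_div_iff hm.ne'] at hc
  rw [← hc, mul_comm]
  exact mul_lt_mul_of_pos_right (hanti hc0.le hm.le hcm) hm

/-- For a Gaussian measure `μ = gaussianReal m v` with `v > 0`,
`m·E[tanh X] − m²·E[1 − tanh²X] ≥ 0`, with equality iff `m = 0`. -/
theorem stmt5 (m : ℝ) (v : NNReal) (hv : 0 < v) :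
    0 ≤ m * (∫ x, Real.tanh x ∂(gaussianReal m v)) -
        m ^ 2 * (∫ x, (1 - Real.tanh x ^ 2) ∂(gaussianReal m v)) ∧
      (m * (∫ x, Real.tanh x ∂(gaussianReal m v)) -
          m ^ 2 * (∫ x, (1 - Real.tanh x ^ 2) ∂(gaussianReal m v)) = 0 ↔ m = 0) := by
  have hpos {m : ℝ} (hm : 0 < m) : 0 < m * (∫ x, Real.tanh x ∂(gaussianReal m v)) -
      m ^ 2 * (∫ x, (1 - Real.tanh x ^ 2) ∂(gaussianReal m v)) := by
    nlinarith [integral_tanh_gaussianReal_gt hm hv]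
  have hne (hm : m ≠ 0) : 0 < m * (∫ x, Real.tanh x ∂(gaussianReal m v)) -
      m ^ 2 * (∫ x, (1 - Real.tanh x ^ 2) ∂(gaussianReal m v)) := by
    rcases hm.lt_or_gt with hm | hm
    · have h := hpos (neg_pos.2 hm)
      simpa only [integral_gaussianReal_neg, Real.tanh_neg, integral_neg, neg_mul_neg, neg_sq]
        using h
    · exact hpos hm
  rcases eq_or_ne m 0 with rfl | hm
  · simp
  · exact ⟨(hne hm).le, iff_of_false (hne hm).ne' hm⟩
end

section
/- Let m ≥ 0 and v > 0, and let μ = gaussianReal m v be the Gaussian measure on ℝ with mean m and variance v. Then 2·∫ tanh″(x) dμ(x) + ∫ tanh‴(x) dμ(x) ≤ 0, where tanh″ = iteratedDeriv 2 Real.tanh is the second derivative of tanh and tanh‴ = iteratedDeriv 3 Real.tanh is the third derivative of tanh. -/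
open MeasureTheory ProbabilityTheory

namespace Real

theorem hasDerivAt_tanh (x : ℝ) : HasDerivAt tanh (1 - tanh x ^ 2) x := by
  have hc := (cosh_pos x).ne'
  have h := (hasDerivAt_sinh x).div (hasDerivAt_cosh x) hc
  have hfun : tanh = sinh / cosh := funext tanh_eq_sinh_div_cosh
  rw [← hfun] at h
  convert! h using 1
  rw [tanh_eq_sinh_div_cosh]
  field_simp

theorem continuous_tanh : Continuous tanh :=
  continuous_iff_continuousAt.2 fun x => (hasDerivAt_tanh x).continuousAt

theorem hasDerivAt_one_sub_tanh_sq (x : ℝ) :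
    HasDerivAt (fun y => 1 - tanh y ^ 2) (-2 * tanh x * (1 - tanh x ^ 2)) x := by
  convert! ((hasDerivAt_tanh x).fun_pow 2).const_sub 1 using 1
  push_cast
  ring

theorem iteratedDeriv_two_tanh :
    iteratedDeriv 2 tanh = fun x => -2 * tanh x * (1 - tanh x ^ 2) := by
  rw [iteratedDeriv_succ, iteratedDeriv_one, funext fun x => (hasDerivAt_tanh x).deriv]
  exact funext fun x => (hasDerivAt_one_sub_tanh_sq x).deriv

theorem hasDerivAt_iteratedDeriv_two_tanh (x : ℝ) :
    HasDerivAt (iteratedDeriv 2 tanh) ((1 - tanh x ^ 2) * (6 * tanh x ^ 2 - 2)) x := by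
  rw [iteratedDeriv_two_tanh]
  convert! ((hasDerivAt_tanh x).const_mul (-2)).fun_mul (hasDerivAt_one_sub_tanh_sq x) using 1
  ring

theorem iteratedDeriv_three_tanh :
    iteratedDeriv 3 tanh = fun x => (1 - tanh x ^ 2) * (6 * tanh x ^ 2 - 2) := by
  rw [iteratedDeriv_succ]
  exact funext fun x => (hasDerivAt_iteratedDeriv_two_tanh x).deriv

theorem continuous_iteratedDeriv_two_tanh : Continuous (iteratedDeriv 2 tanh) := by
  rw [iteratedDeriv_two_tanh]
  have := continuous_tanh
  fun_prop

theorem continuous_iteratedDeriv_three_tanh : Continuous (iteratedDeriv 3 tanh) := by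
  rw [iteratedDeriv_three_tanh]
  have := continuous_tanh
  fun_prop

theorem iteratedDeriv_two_tanh_neg (x : ℝ) :
    iteratedDeriv 2 tanh (-x) = -iteratedDeriv 2 tanh x := by
  simp only [iteratedDeriv_two_tanh, tanh_neg]
  ring

theorem abs_iteratedDeriv_two_tanh_le (x : ℝ) : |iteratedDeriv 2 tanh x| ≤ 2 := by
  rw [iteratedDeriv_two_tanh]
  have h1 := tanh_lt_one x
  have h2 := neg_one_lt_tanh x
  have h3 := tanh_sq_lt_one x
  rw [abs_le]
  constructor <;> nlinarith [sq_nonneg (tanh x)]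

theorem abs_iteratedDeriv_three_tanh_le (x : ℝ) : |iteratedDeriv 3 tanh x| ≤ 4 := by
  rw [iteratedDeriv_three_tanh]
  have h3 := tanh_sq_lt_one x
  rw [abs_le]
  constructor <;> nlinarith [sq_nonneg (tanh x)]

theorem mul_iteratedDeriv_two_tanh_nonpos (x : ℝ) : x * iteratedDeriv 2 tanh x ≤ 0 := by
  have h3 := tanh_sq_lt_one x
  have hx : 0 ≤ x * tanh x := by
    rw [tanh_eq_sinh_div_cosh]
    rcases le_total 0 x with h | h
    · exact mul_nonneg h (div_nonneg (sinh_nonneg_iff.2 h) (cosh_pos x).le)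
    · exact mul_nonneg_of_nonpos_of_nonpos h
        (div_nonpos_of_nonpos_of_nonneg (sinh_nonpos_iff.2 h) (cosh_pos x).le)
  rw [iteratedDeriv_two_tanh]
  nlinarith

theorem two_mul_iteratedDeriv_two_tanh_add_mul_sub_nonpos {f : ℝ → ℝ} (hf : Monotone f) (x : ℝ) :
    (2 * iteratedDeriv 2 tanh x + iteratedDeriv 3 tanh x) * (f x - f (artanh (-1 / 3))) ≤ 0 := by
  have h1 := tanh_lt_one x
  have h2 := neg_one_lt_tanh x
  have h3 := tanh_sq_lt_one x
  have hfac : 2 * iteratedDeriv 2 tanh x + iteratedDeriv 3 tanh x =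
      2 * ((1 - tanh x ^ 2) * (1 - tanh x)) * (-(3 * tanh x + 1)) := by
    rw [iteratedDeriv_two_tanh, iteratedDeriv_three_tanh]
    ring
  have hp : 0 ≤ (1 - tanh x ^ 2) * (1 - tanh x) := mul_nonneg (by linarith) (by linarith)
  rw [hfac]
  rcases le_total (-1 / 3) (tanh x) with h | h
  · have := artanh_le_artanh (by norm_num) h1 h
    rw [artanh_tanh] at this
    have := hf this
    exact mul_nonpos_of_nonpos_of_nonneg
      (mul_nonpos_of_nonneg_of_nonpos (by linarith) (by linarith)) (by linarith)
  · have := artanh_le_artanh h2 (by norm_num) h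
    rw [artanh_tanh] at this
    have := hf this
    exact mul_nonpos_of_nonneg_of_nonpos (mul_nonneg (by linarith) (by linarith)) (by linarith)

end Real

namespace ProbabilityTheory

open Real

theorem hasDerivAt_gaussianPDFReal (m : ℝ) (v : NNReal) (x : ℝ) :
    HasDerivAt (gaussianPDFReal m v) (-((x - m) / v) * gaussianPDFReal m v x) x := by
  rw [gaussianPDFReal_def]
  convert! (((((hasDerivAt_id x).sub_const m).fun_pow 2).fun_neg.div_const
    (2 * (v : ℝ))).exp).const_mul ((√(2 * π * v))⁻¹) using 1
  simp only [id]
  push_cast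
  rcases eq_or_ne (v : ℝ) 0 with h | h
  · simp [h]
  · field_simp

theorem gaussianPDFReal_eq_mul_exp (m : ℝ) {v : NNReal} (hv : v ≠ 0) (x : ℝ) :
    gaussianPDFReal m v x =
      exp (-m ^ 2 / (2 * v)) * gaussianPDFReal 0 v x * exp (m / v * x) := by
  have h : (v : ℝ) ≠ 0 := by exact_mod_cast hv
  have hexp : -(x - m) ^ 2 / (2 * v) =
      -m ^ 2 / (2 * v) + -(x - 0) ^ 2 / (2 * v) + m / v * x := by
    field_simp
    ring
  rw [gaussianPDFReal, gaussianPDFReal, hexp, exp_add, exp_add]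
  ring

theorem integrable_mul_gaussianPDFReal_zero {v : NNReal} (hv : v ≠ 0) :
    Integrable fun x => x * gaussianPDFReal 0 v x := by
  have h : 0 < (v : ℝ) := by positivity
  convert! (integrable_mul_exp_neg_mul_sq (b := (2 * (v : ℝ))⁻¹) (by positivity)).const_mul
    ((√(2 * π * v))⁻¹) using 2 with x
  rw [gaussianPDFReal, sub_zero, neg_div, div_eq_inv_mul, neg_mul]
  ring

theorem integral_gaussianPDFReal_zero_mul_of_odd (v : NNReal) {f : ℝ → ℝ}
    (hf : ∀ x, f (-x) = -f x) : ∫ x, gaussianPDFReal 0 v x * f x = 0 := by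
  have h := integral_neg_eq_self (fun x => gaussianPDFReal 0 v x * f x) volume
  have he (x : ℝ) : gaussianPDFReal 0 v (-x) * f (-x) = -(gaussianPDFReal 0 v x * f x) := by
    simp [gaussianPDFReal, hf]
  simp_rw [he, integral_neg] at h
  linarith

theorem gaussianPDFReal_mul_iteratedDeriv_tanh_le {m : ℝ} (hm : 0 ≤ m) {v : NNReal}
    (hv : v ≠ 0) (x : ℝ) :
    2 * (gaussianPDFReal m v x * iteratedDeriv 2 tanh x) +
        gaussianPDFReal m v x * iteratedDeriv 3 tanh x ≤
      exp (-m ^ 2 / (2 * v)) * exp (m / v * artanh (-1 / 3)) *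
        (2 * (gaussianPDFReal 0 v x * iteratedDeriv 2 tanh x) +
          (gaussianPDFReal 0 v x * iteratedDeriv 3 tanh x -
            (v : ℝ)⁻¹ * (x * gaussianPDFReal 0 v x * iteratedDeriv 2 tanh x))) := by
  have hmono : Monotone fun y : ℝ => exp (m / v * y) := fun a b hab =>
    exp_le_exp.2 (mul_le_mul_of_nonneg_left hab (by positivity))
  have hp := gaussianPDFReal_nonneg 0 v x
  have hsign := mul_nonpos_of_nonneg_of_nonpos (mul_nonneg (exp_pos (-m ^ 2 / (2 * v))).le hp)
    (two_mul_iteratedDeriv_two_tanh_add_mul_sub_nonpos hmono x)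
  have hK : 0 ≤ exp (-m ^ 2 / (2 * v)) * exp (m / v * artanh (-1 / 3)) * (v : ℝ)⁻¹ := by
    positivity
  have hx := mul_nonpos_of_nonneg_of_nonpos (mul_nonneg hK hp)
    (mul_iteratedDeriv_two_tanh_nonpos x)
  rw [gaussianPDFReal_eq_mul_exp m hv x]
  linear_combination hsign + hx

theorem integrable_mul_iteratedDeriv_two_tanh {p : ℝ → ℝ} (hp : Integrable p) :
    Integrable fun x => p x * iteratedDeriv 2 tanh x :=
  hp.mul_bdd continuous_iteratedDeriv_two_tanh.aestronglyMeasurable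
    (ae_of_all _ abs_iteratedDeriv_two_tanh_le)

theorem integrable_mul_iteratedDeriv_three_tanh {p : ℝ → ℝ} (hp : Integrable p) :
    Integrable fun x => p x * iteratedDeriv 3 tanh x :=
  hp.mul_bdd continuous_iteratedDeriv_three_tanh.aestronglyMeasurable
    (ae_of_all _ abs_iteratedDeriv_three_tanh_le)

theorem integrable_deriv_gaussianPDFReal_mul_iteratedDeriv_two_tanh {v : NNReal} (hv : v ≠ 0) :
    Integrable fun x => gaussianPDFReal 0 v x * iteratedDeriv 3 tanh x -
      (v : ℝ)⁻¹ * (x * gaussianPDFReal 0 v x * iteratedDeriv 2 tanh x) :=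
  (integrable_mul_iteratedDeriv_three_tanh (integrable_gaussianPDFReal 0 v)).sub
    ((integrable_mul_iteratedDeriv_two_tanh (integrable_mul_gaussianPDFReal_zero hv)).const_mul _)

theorem integral_deriv_gaussianPDFReal_mul_iteratedDeriv_two_tanh {v : NNReal} (hv : v ≠ 0) :
    ∫ x, (gaussianPDFReal 0 v x * iteratedDeriv 3 tanh x -
      (v : ℝ)⁻¹ * (x * gaussianPDFReal 0 v x * iteratedDeriv 2 tanh x)) = 0 := by
  refine integral_eq_zero_of_hasDerivAt_of_integrable (fun x => ?_)
    (integrable_deriv_gaussianPDFReal_mul_iteratedDeriv_two_tanh hv)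
    (integrable_mul_iteratedDeriv_two_tanh (integrable_gaussianPDFReal 0 v))
  convert! (hasDerivAt_gaussianPDFReal 0 v x).fun_mul (hasDerivAt_iteratedDeriv_two_tanh x) using 1
  rw [iteratedDeriv_three_tanh]
  ring

end ProbabilityTheory

open Real in
/-- For a Gaussian measure `μ = gaussianReal m v` with mean `m ≥ 0` and
variance `v > 0`, we have `2·E[tanh″(X)] + E[tanh‴(X)] ≤ 0`. -/
theorem stmt7 (m : ℝ) (hm : 0 ≤ m) (v : NNReal) (hv : 0 < v) :
    2 * (∫ x, iteratedDeriv 2 Real.tanh x ∂(gaussianReal m v)) +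
        (∫ x, iteratedDeriv 3 Real.tanh x ∂(gaussianReal m v)) ≤ 0 := by
  have h2 (a : ℝ) := (integrable_mul_iteratedDeriv_two_tanh
    (integrable_gaussianPDFReal a v)).const_mul 2
  have h3 := integrable_mul_iteratedDeriv_three_tanh (integrable_gaussianPDFReal m v)
  have hd := integrable_deriv_gaussianPDFReal_mul_iteratedDeriv_two_tanh hv.ne'
  rw [integral_gaussianReal_eq_integral_smul hv.ne', integral_gaussianReal_eq_integral_smul hv.ne']
  simp only [smul_eq_mul]
  rw [← integral_const_mul, ← integral_add (h2 m) h3]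
  refine (integral_mono ((h2 m).add h3) (((h2 0).add hd).const_mul _)
    (gaussianPDFReal_mul_iteratedDeriv_tanh_le hm hv.ne')).trans_eq ?_
  rw [integral_const_mul]
  refine mul_eq_zero_of_right _ ?_
  refine (integral_add (h2 0) hd).trans ?_
  rw [integral_const_mul, integral_gaussianPDFReal_zero_mul_of_odd v iteratedDeriv_two_tanh_neg,
    integral_deriv_gaussianPDFReal_mul_iteratedDeriv_two_tanh hv.ne', mul_zero, zero_add]
end

section
/- Let s > 0 and let γ = gaussianReal 0 1 be the standard Gaussian measure on ℝ. Define g : ℝ → ℝ by g(m) = ∫ (m + √(s − m²)·z)·tanh(m + √(s − m²)·z) dγ(z). Then for every m with 0 < m < √s satisfying 2m² − 2m·√(s − m²) ≥ s, there exists c > 0 such that g has derivative c at m (HasDerivAt g c m). -/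
open MeasureTheory ProbabilityTheory

lemma hasDerivAt_real_tanh (x : ℝ) : HasDerivAt Real.tanh (1 / Real.cosh x ^ 2) x := by
  have h := (Real.hasDerivAt_sinh x).div (Real.hasDerivAt_cosh x) (Real.cosh_pos x).ne'
  have e : Real.tanh = Real.sinh / Real.cosh := by
    ext y; exact Real.tanh_eq_sinh_div_cosh y
  rw [e]
  refine h.congr_deriv ?_
  rw [← Real.cosh_sq_sub_sinh_sq x]
  ring

lemma strictAntiOn_tanh_div_self : StrictAntiOn (fun x => Real.tanh x / x) (Set.Ioi 0) := by
  have hd : ∀ x ∈ Set.Ioi (0 : ℝ), HasDerivAt (fun x => Real.tanh x / x)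
      ((1 / Real.cosh x ^ 2 * x - Real.tanh x * 1) / x ^ 2) x := fun x hx =>
    (hasDerivAt_real_tanh x).div (hasDerivAt_id x) (ne_of_gt hx)
  refine strictAntiOn_of_deriv_neg (convex_Ioi 0)
    (fun x hx => (hd x hx).continuousAt.continuousWithinAt) fun x hx => ?_
  rw [interior_Ioi] at hx
  rw [(hd x hx).deriv]
  have hx : 0 < x := hx
  have hc := Real.cosh_pos x
  have hlt : x < Real.sinh x * Real.cosh x := by
    nlinarith [Real.self_lt_sinh_iff.2 hx, Real.one_le_cosh x]
  refine div_neg_of_neg_of_pos ?_ (by positivity)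
  have : 1 / Real.cosh x ^ 2 * x - Real.tanh x * 1
      = (x - Real.sinh x * Real.cosh x) / Real.cosh x ^ 2 := by
    rw [Real.tanh_eq_sinh_div_cosh]; field_simp
  rw [this]
  exact div_neg_of_neg_of_pos (by linarith) (by positivity)

/-- The derivative of `x ↦ x * tanh x`. -/
noncomputable def derivMulTanh (x : ℝ) : ℝ := Real.tanh x + x / Real.cosh x ^ 2

lemma hasDerivAt_mul_tanh (x : ℝ) :
    HasDerivAt (fun y => y * Real.tanh y) (derivMulTanh x) x := by
  refine ((hasDerivAt_id x).mul (hasDerivAt_real_tanh x)).congr_deriv ?_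
  simp only [derivMulTanh, id]
  ring

lemma continuous_real_tanh : Continuous Real.tanh :=
  continuous_iff_continuousAt.2 fun x => (hasDerivAt_real_tanh x).continuousAt

lemma continuous_derivMulTanh : Continuous derivMulTanh :=
  continuous_real_tanh.add
    (continuous_id.div (Real.continuous_cosh.pow 2) fun x => pow_ne_zero 2 (Real.cosh_pos x).ne')

lemma derivMulTanh_neg (x : ℝ) : derivMulTanh (-x) = -derivMulTanh x := by
  simp only [derivMulTanh, Real.tanh_neg, Real.cosh_neg]
  ring

lemma strictAntiOn_derivMulTanh_div_self :
    StrictAntiOn (fun x => derivMulTanh x / x) (Set.Ioi 0) := by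
  intro x hx y hy hxy
  have hx : 0 < x := hx
  have hy : 0 < y := hy
  have h1 : Real.tanh y / y < Real.tanh x / x := strictAntiOn_tanh_div_self hx hy hxy
  have hcosh : Real.cosh x < Real.cosh y := by
    rw [Real.cosh_lt_cosh, abs_of_pos hx, abs_of_pos hy]; exact hxy
  have hc := Real.cosh_pos x
  have h2 : 1 / Real.cosh y ^ 2 < 1 / Real.cosh x ^ 2 :=
    one_div_lt_one_div_of_lt (by positivity) (by gcongr)
  have e : ∀ t : ℝ, 0 < t → derivMulTanh t / t = Real.tanh t / t + 1 / Real.cosh t ^ 2 := by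
    intro t ht
    have := Real.cosh_pos t
    simp only [derivMulTanh]
    field_simp
  simp only [e x hx, e y hy]
  linarith

lemma abs_real_tanh_le_one (x : ℝ) : |Real.tanh x| ≤ 1 :=
  abs_le.2 ⟨(Real.neg_one_lt_tanh x).le, (Real.tanh_lt_one x).le⟩

lemma abs_derivMulTanh_le_two (x : ℝ) : |derivMulTanh x| ≤ 2 := by
  have hc := Real.cosh_pos x
  have h1 := abs_real_tanh_le_one x
  have h2 : |x / Real.cosh x ^ 2| ≤ 1 := by
    rw [abs_div, abs_of_pos (pow_pos hc 2), div_le_one (by positivity), Real.cosh_sq,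
      ← sq_abs (Real.sinh x)]
    have h3 : |x| ≤ |Real.sinh x| := by
      rw [Real.abs_sinh]; exact Real.self_le_sinh_iff.2 (abs_nonneg x)
    nlinarith [sq_nonneg (|Real.sinh x| - 1)]
  calc |derivMulTanh x| ≤ |Real.tanh x| + |x / Real.cosh x ^ 2| := abs_add_le _ _
    _ ≤ 2 := by linarith

/-- For `0 < v < s`, the function `s * sinh y - v * y * cosh y` on the positive half-line changes
sign exactly once, from positive to negative. -/
lemma exists_sign_change_sinh_cosh {v s : ℝ} (hv : 0 < v) (hvs : v < s) :
    ∃ y₀ > 0, (∀ y, 0 < y → y < y₀ → 0 < s * Real.sinh y - v * y * Real.cosh y) ∧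
      ∀ y, y₀ < y → s * Real.sinh y - v * y * Real.cosh y < 0 := by
  have hs : 0 < s := hv.trans hvs
  have key : ∀ y, 0 < y → s * Real.sinh y - v * y * Real.cosh y
      = s * y * Real.cosh y * (Real.tanh y / y - v / s) := by
    intro y hy
    have := Real.cosh_pos y
    rw [Real.tanh_eq_sinh_div_cosh]
    field_simp
  have hpos : ∀ y, 0 < y → 0 < s * y * Real.cosh y := fun y hy => by
    have := Real.cosh_pos y
    positivity
  set f : ℝ → ℝ := fun y => s * Real.sinh y - v * y * Real.cosh y with hf
  have hfc : Continuous f := by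
    have := Real.continuous_sinh
    have := Real.continuous_cosh
    fun_prop
  obtain ⟨a, ha, hfa⟩ : ∃ a > 0, 0 < f a := by
    have hd : HasDerivAt f (s - v) 0 := by
      have := ((Real.hasDerivAt_sinh 0).const_mul s).sub
        (((hasDerivAt_id (0 : ℝ)).const_mul v).mul (Real.hasDerivAt_cosh 0))
      exact this.congr_deriv (by simp)
    have h0 : f 0 = 0 := by simp [hf]
    have := (hasDerivAt_iff_tendsto_slope.1 hd).eventually_const_lt (sub_pos.2 hvs)
    have h' : ∀ᶠ y in nhdsWithin (0 : ℝ) (Set.Ioi 0), 0 < slope f 0 y :=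
      this.filter_mono (nhdsWithin_mono _ fun y hy => ne_of_gt hy)
    obtain ⟨y, hy, hy0⟩ := (h'.and self_mem_nhdsWithin).exists
    have hy0 : 0 < y := hy0
    refine ⟨y, hy0, ?_⟩
    rw [slope_def_field, h0, sub_zero, sub_zero] at hy
    exact (div_pos_iff_of_pos_right hy0).1 hy
  have hb : f (s / v) < 0 := by
    have h0 : 0 < s / v := by positivity
    simp only [hf]
    rw [key _ h0]
    refine mul_neg_of_pos_of_neg (hpos _ h0) ?_
    have := Real.tanh_lt_one (s / v)
    rw [sub_neg, div_lt_iff₀ h0]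
    calc _ < 1 := this
      _ = _ := by field_simp
  obtain ⟨y₀, hy₀, hfy⟩ : ∃ y₀ > 0, f y₀ = 0 := by
    obtain ⟨y, hy, hy'⟩ := isPreconnected_Ioi.intermediate_value₂ (s := Set.Ioi (0 : ℝ))
      (a := s / v) (b := a) (f := f) (g := fun _ => 0)
      (Set.mem_Ioi.2 (by positivity)) ha hfc.continuousOn continuousOn_const hb.le hfa.le
    exact ⟨y, hy, hy'⟩
  have hy₀eq : Real.tanh y₀ / y₀ = v / s := by
    simp only [hf] at hfy
    rw [key _ hy₀] at hfy
    linarith [(mul_eq_zero.1 hfy).resolve_left (hpos _ hy₀).ne']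
  refine ⟨y₀, hy₀, fun y hy hlt => ?_, fun y hlt => ?_⟩
  · rw [key y hy]
    have : Real.tanh y₀ / y₀ < Real.tanh y / y := strictAntiOn_tanh_div_self hy hy₀ hlt
    exact mul_pos (hpos y hy) (by linarith)
  · have hy : 0 < y := hy₀.trans hlt
    rw [key y hy]
    have : Real.tanh y / y < Real.tanh y₀ / y₀ := strictAntiOn_tanh_div_self hy₀ hy hlt
    exact mul_neg_of_pos_of_neg (hpos y hy) (by linarith)

/-- If `h` is odd and `h x / x` is strictly decreasing on the positive half-line, then
`E[h(X) (E[X²] - E[X] X)] > 0` for a nondegenerate Gaussian variable `X` with positive mean. -/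
lemma integral_gaussianReal_pos_of_odd_s8 {m : ℝ} {v : NNReal} (hm : 0 < m) (hv : v ≠ 0)
    {h : ℝ → ℝ} (hc : Continuous h) (hodd : ∀ x, h (-x) = -h x)
    (hanti : StrictAntiOn (fun x => h x / x) (Set.Ioi 0))
    (hint : Integrable (fun x => h x * (m ^ 2 + v - m * x)) (gaussianReal m v)) :
    0 < ∫ x, h x * (m ^ 2 + v - m * x) ∂(gaussianReal m v) := by
  have hv' : (0 : ℝ) < v := by positivity
  obtain ⟨y₀, hy₀, hlt, hgt⟩ := exists_sign_change_sinh_cosh (s := m ^ 2 + v) hv' (by nlinarith)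
  set x₀ : ℝ := v * y₀ / m with hx₀
  have hx₀pos : 0 < x₀ := by positivity
  set c : ℝ := h x₀ / x₀ with hcdef
  have hsq : Integrable (fun x : ℝ => x ^ 2) (gaussianReal m v) :=
    (memLp_id_gaussianReal 2).integrable_sq
  have hid : Integrable (fun x : ℝ => x) (gaussianReal m v) :=
    (memLp_id_gaussianReal 1).integrable le_rfl
  have hmom : ∫ x, x ^ 2 ∂(gaussianReal m v) = m ^ 2 + v := by
    have h1 := variance_eq_sub (memLp_id_gaussianReal (μ := m) (v := v) 2)
    rw [variance_id_gaussianReal] at h1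
    simp only [id, Pi.pow_apply, integral_id_gaussianReal] at h1
    linarith
  have hquad : Integrable (fun x : ℝ => c * ((m ^ 2 + v) * x - m * x ^ 2)) (gaussianReal m v) :=
    ((hid.const_mul _).sub (hsq.const_mul _)).const_mul _
  have hzero : ∫ x, c * ((m ^ 2 + v) * x - m * x ^ 2) ∂(gaussianReal m v) = 0 := by
    rw [integral_const_mul, integral_sub (hid.const_mul _) (hsq.const_mul _),
      integral_const_mul, integral_const_mul, hmom, integral_id_gaussianReal]
    ring
  set F : ℝ → ℝ := fun x => h x * (m ^ 2 + v - m * x) - c * ((m ^ 2 + v) * x - m * x ^ 2)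
    with hF
  have hFint : Integrable F (gaussianReal m v) := hint.sub hquad
  have hFeq : ∫ x, h x * (m ^ 2 + v - m * x) ∂(gaussianReal m v)
      = ∫ x, gaussianPDFReal m v x * F x := by
    rw [← sub_zero (∫ x, h x * (m ^ 2 + v - m * x) ∂(gaussianReal m v)), ← hzero,
      ← integral_sub hint hquad, integral_gaussianReal_eq_integral_smul hv]
    rfl
  have hKint : Integrable (fun x => gaussianPDFReal m v x * F x) := by
    rw [gaussianReal_of_var_ne_zero _ hv, integrable_withDensity_iff_integrable_smul'
      (measurable_gaussianPDF m v) (ae_of_all _ fun _ => gaussianPDF_lt_top)] at hFint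
    simpa only [toReal_gaussianPDF, smul_eq_mul] using hFint
  have hsymm : 2 * ∫ x, gaussianPDFReal m v x * F x
      = ∫ x, (gaussianPDFReal m v x * F x + gaussianPDFReal m v (-x) * F (-x)) := by
    rw [integral_add hKint hKint.comp_neg,
      integral_neg_eq_self (fun x => gaussianPDFReal m v x * F x)]
    ring
  set G : ℝ → ℝ := fun x => (√(2 * Real.pi * v))⁻¹ * Real.exp (-(x ^ 2 + m ^ 2) / (2 * v)) *
    (h x - c * x) * (2 * ((m ^ 2 + v) * Real.sinh (m * x / v)
      - v * (m * x / v) * Real.cosh (m * x / v))) with hG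
  have hGeq : ∀ x, gaussianPDFReal m v x * F x + gaussianPDFReal m v (-x) * F (-x) = G x := by
    intro x
    have e : ∀ t : ℝ, gaussianPDFReal m v t = (√(2 * Real.pi * v))⁻¹ *
        Real.exp (-(t ^ 2 + m ^ 2) / (2 * v)) * Real.exp (m * t / v) := by
      intro t
      rw [gaussianPDFReal, mul_assoc _ (Real.exp _), ← Real.exp_add]
      congr 2
      field_simp
      ring
    rw [e, e, show m * -x / (v : ℝ) = -(m * x / v) by ring, neg_sq]
    simp only [hG, hF, hodd]
    rw [Real.sinh_eq, Real.cosh_eq, show (v : ℝ) * (m * x / v) = m * x by field_simp]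
    ring
  have hGpos : ∀ x, 0 < x → x ≠ x₀ → 0 < G x := by
    intro x hx hne
    have hA : 0 < (√(2 * Real.pi * v))⁻¹ * Real.exp (-(x ^ 2 + m ^ 2) / (2 * v)) := by positivity
    have hfac : h x - c * x = x * (h x / x - h x₀ / x₀) := by rw [hcdef]; field_simp
    simp only [hG]
    rw [mul_assoc]
    refine mul_pos hA ?_
    have hy : 0 < m * x / v := by positivity
    rcases lt_or_gt_of_ne hne with hl | hl
    · have h1 : h x₀ / x₀ < h x / x := hanti hx hx₀pos hl
      have h2 : m * x / v < y₀ := by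
        rw [hx₀, lt_div_iff₀ hm] at hl
        rw [div_lt_iff₀ hv']; linarith
      rw [hfac]
      exact mul_pos (mul_pos hx (by linarith)) (by linarith [hlt _ hy h2])
    · have h1 : h x / x < h x₀ / x₀ := hanti hx₀pos hx hl
      have h2 : y₀ < m * x / v := by
        rw [hx₀, div_lt_iff₀ hm] at hl
        rw [lt_div_iff₀ hv']; linarith
      rw [hfac]
      exact mul_pos_of_neg_of_neg (mul_neg_of_pos_of_neg hx (by linarith))
        (by linarith [hgt _ h2])
  have hGc : Continuous G := by
    have := Real.continuous_sinh
    have := Real.continuous_cosh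
    fun_prop
  have hGnonneg_of_pos : ∀ x, 0 < x → 0 ≤ G x := by
    intro x hx
    rcases eq_or_ne x x₀ with rfl | hne
    · refine le_of_eq ?_
      have : h x₀ - c * x₀ = 0 := by rw [hcdef]; field_simp; ring
      simp only [hG, this]
      ring
    · exact (hGpos x hx hne).le
  have hGeven : ∀ x, G (-x) = G x := fun x => by
    rw [← hGeq, ← hGeq, neg_neg, add_comm]
  have hGnonneg : 0 ≤ G := by
    intro x
    rcases lt_trichotomy x 0 with hx | rfl | hx
    · rw [← hGeven]; exact hGnonneg_of_pos _ (by linarith)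
    · simp [hG]
    · exact hGnonneg_of_pos x hx
  have hGint : Integrable G :=
    (hKint.add hKint.comp_neg).congr (ae_of_all _ hGeq)
  have hmain : 0 < ∫ x, G x :=
    integral_pos_of_integrable_nonneg_nonzero hGc hGint hGnonneg
      (hGpos (2 * x₀) (by positivity) (by linarith)).ne'
  simp only [hGeq] at hsymm
  rw [hFeq]
  linarith

lemma hasDerivAt_sqrt_sub_sq {s m : ℝ} (h : 0 < s - m ^ 2) :
    HasDerivAt (fun x => √(s - x ^ 2)) (-(m / √(s - m ^ 2))) m := by
  have h1 : HasDerivAt (fun x : ℝ => s - x ^ 2) (-(2 * m)) m := by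
    simpa using (hasDerivAt_pow 2 m).const_sub s
  refine (h1.sqrt h.ne').congr_deriv ?_
  field_simp

lemma hasDerivAt_integral_mul_tanh {s m : ℝ} (h : 0 < s - m ^ 2) :
    Integrable (fun z => derivMulTanh (m + √(s - m ^ 2) * z) * (1 + -(m / √(s - m ^ 2)) * z))
      (gaussianReal 0 1) ∧
    HasDerivAt (fun m => ∫ z, (m + √(s - m ^ 2) * z) * Real.tanh (m + √(s - m ^ 2) * z)
        ∂(gaussianReal 0 1))
      (∫ z, derivMulTanh (m + √(s - m ^ 2) * z) * (1 + -(m / √(s - m ^ 2)) * z)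
        ∂(gaussianReal 0 1)) m := by
  have hid : Integrable (fun z : ℝ => z) (gaussianReal 0 1) :=
    (memLp_id_gaussianReal 1).integrable le_rfl
  set C : ℝ := |m / √(s - m ^ 2)| + 1
  have hcont : ContinuousAt (fun x => |x / √(s - x ^ 2)|) m := by
    have : √(s - m ^ 2) ≠ 0 := (Real.sqrt_pos.2 h).ne'
    have hsqrt : ContinuousAt (fun x : ℝ => √(s - x ^ 2)) m := by fun_prop
    exact (continuousAt_id.div hsqrt this).abs
  have hnhds : {x : ℝ | 0 < s - x ^ 2 ∧ |x / √(s - x ^ 2)| < C} ∈ nhds m := by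
    have h1 : ∀ᶠ x : ℝ in nhds m, 0 < s - x ^ 2 :=
      Filter.Tendsto.eventually_const_lt h
        (show ContinuousAt (fun x : ℝ => s - x ^ 2) m by fun_prop)
    exact h1.and (Filter.Tendsto.eventually_lt_const (lt_add_one _) hcont)
  have hmeas : ∀ x : ℝ, AEStronglyMeasurable
      (fun z => (x + √(s - x ^ 2) * z) * Real.tanh (x + √(s - x ^ 2) * z))
      (gaussianReal 0 1) := fun x => by
    have := continuous_real_tanh
    exact Continuous.aestronglyMeasurable (by fun_prop)
  refine hasDerivAt_integral_of_dominated_loc_of_deriv_le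
    (F' := fun x z => derivMulTanh (x + √(s - x ^ 2) * z) * (1 + -(x / √(s - x ^ 2)) * z))
    (bound := fun z => 2 * (1 + C * |z|)) hnhds (Filter.Eventually.of_forall hmeas) ?_ ?_
    (ae_of_all _ ?_) ?_ (ae_of_all _ ?_)
  · have hlin : Integrable (fun z : ℝ => m + √(s - m ^ 2) * z) (gaussianReal 0 1) :=
      (integrable_const m).add (hid.const_mul _)
    refine hlin.mono (hmeas m) (ae_of_all _ fun z => ?_)
    rw [norm_mul]
    exact mul_le_of_le_one_right (norm_nonneg _) (abs_real_tanh_le_one _)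
  · have := continuous_derivMulTanh
    exact Continuous.aestronglyMeasurable (by fun_prop)
  · intro z x hx
    rw [norm_mul, Real.norm_eq_abs, Real.norm_eq_abs]
    refine mul_le_mul (abs_derivMulTanh_le_two _) ?_ (abs_nonneg _) zero_le_two
    refine (abs_add_le _ _).trans ?_
    rw [abs_one, abs_mul, abs_neg]
    gcongr
    exact hx.2.le
  · exact ((integrable_const 1).add (hid.abs.const_mul C)).const_mul 2
  · intro z x hx
    have hin : HasDerivAt (fun x => x + √(s - x ^ 2) * z) (1 + -(x / √(s - x ^ 2)) * z) x :=
      (hasDerivAt_id x).add ((hasDerivAt_sqrt_sub_sq hx.1).mul_const z)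
    exact (hasDerivAt_mul_tanh _).comp x hin

/-- For `s > 0` let `g(m) = E_{z∼N(0,1)}[(m + √(s−m²)z)·tanh(m + √(s−m²)z)]`.
For every `0 < m < √s` satisfying `2m² − 2m√(s−m²) ≥ s`, `g` has some strictly positive
derivative `c` at `m`. -/
theorem stmt8 (s : ℝ) (hs : 0 < s)
    (g : ℝ → ℝ)
    (hg : g = fun m => ∫ z, (m + Real.sqrt (s - m ^ 2) * z) *
      Real.tanh (m + Real.sqrt (s - m ^ 2) * z) ∂(gaussianReal 0 1))
    (m : ℝ) (hm0 : 0 < m) (hms : m < Real.sqrt s)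
    (hsep : s ≤ 2 * m ^ 2 - 2 * m * Real.sqrt (s - m ^ 2)) :
    ∃ c > 0, HasDerivAt g c m := by
  have hd : 0 < s - m ^ 2 := sub_pos.2 ((Real.lt_sqrt hm0.le).1 hms)
  have hσ : 0 < √(s - m ^ 2) := Real.sqrt_pos.2 hd
  obtain ⟨hint, hderiv⟩ := hasDerivAt_integral_mul_tanh hd
  refine ⟨_, ?_, hg ▸ hderiv⟩
  set σ := √(s - m ^ 2) with hσdef
  set v : NNReal := ⟨σ ^ 2, sq_nonneg σ⟩ with hvdef
  have hvcoe : (v : ℝ) = σ ^ 2 := rfl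
  have hv : v ≠ 0 := by
    rw [← NNReal.coe_ne_zero, hvcoe]; positivity
  have hmap : (gaussianReal 0 1).map (fun z => m + σ * z) = gaussianReal m v := by
    rw [← Function.comp_def (fun y => m + y) (fun z => σ * z),
      ← Measure.map_map (by fun_prop) (by fun_prop), gaussianReal_map_const_mul,
      gaussianReal_map_const_add]
    congr 1
    · simp
    · ext; simp [hvcoe]
  have hh : Continuous fun x => derivMulTanh x * (m ^ 2 + v - m * x) :=
    continuous_derivMulTanh.mul (by fun_prop)
  have hφ : AEMeasurable (fun z : ℝ => m + σ * z) (gaussianReal 0 1) := by fun_prop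
  have hpt : ∀ z, derivMulTanh (m + σ * z) * (m ^ 2 + v - m * (m + σ * z))
      = σ ^ 2 * (derivMulTanh (m + σ * z) * (1 + -(m / σ) * z)) := by
    intro z
    rw [hvcoe]
    field_simp
    ring
  have hpos := integral_gaussianReal_pos_of_odd_s8 hm0 hv continuous_derivMulTanh derivMulTanh_neg
    strictAntiOn_derivMulTanh_div_self (by
      rw [← hmap, integrable_map_measure hh.aestronglyMeasurable hφ]
      simpa only [Function.comp_def, hpt] using hint.const_mul (σ ^ 2))
  rw [← hmap, integral_map hφ hh.aestronglyMeasurable] at hpos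
  simp only [hpt, integral_const_mul] at hpos
  exact (mul_pos_iff_of_pos_left (by positivity)).1 hpos
end

section
/- Let (Ω, 𝓕, P) be a probability space, d, k positive natural numbers, X : Ω → ℝ^d a measurable random vector with ∫ ‖X‖⁴ dP < ∞, Y : Ω → Fin k a measurable random label, and f : ℝ^d → Fin k a measurable classifier. Let Γ_1,…,Γ_k be d×d real matrices and μ_1,…,μ_k, μ̃_1,…,μ̃_k ∈ ℝ^d, and define Ψ(x, i) = Γ_i·(x − μ_i) + μ̃_i. Set P_e = P( f(X) ≠ Y ). Then E[ ‖Ψ(X,Y) − E[Ψ(X,Y) | X]‖² ] ≤ E[ ‖Ψ(X,Y) − Ψ(X, f(X))‖² ] ≤ 8·√P_e · (max_{1≤i≤k} ‖Γ_i‖²) · √(E[‖X‖⁴]) + 8·P_e · max_{1≤i≤k} ‖Γ_i·μ_i − μ̃_i‖², where E[· | X] denotes conditional expectation with respect to the σ-algebra generated by X and ‖Γ_i‖ is the operator norm of Γ_i. -/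
open MeasureTheory
open scoped RealInnerProductSpace

section AuxiliaryLemmas

variable {Ω E F : Type*} {mΩ : MeasurableSpace Ω} {P : Measure Ω}
  [NormedAddCommGroup E] [InnerProductSpace ℝ E] [NormedAddCommGroup F] [InnerProductSpace ℝ F]

/-- The conditional expectation minimizes the mean square error among all square-integrable
functions measurable with respect to the conditioning σ-algebra. -/
theorem integral_norm_sub_condExp_sq_le [CompleteSpace E] [IsFiniteMeasure P]
    {m : MeasurableSpace Ω} (hm : m ≤ mΩ) {f g : Ω → E} (hf : MemLp f 2 P) (hg : MemLp g 2 P)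
    (hgm : AEStronglyMeasurable[m] g P) :
    ∫ ω, ‖f ω - (P[f | m]) ω‖ ^ 2 ∂P ≤ ∫ ω, ‖f ω - g ω‖ ^ 2 ∂P := by
  have hc : MemLp (P[f | m]) 2 P := hf.condExp one_le_two
  have hu : MemLp (f - P[f | m]) 2 P := hf.sub hc
  have hv : MemLp (P[f | m] - g) 2 P := hc.sub hg
  have hvm : AEStronglyMeasurable[m] (P[f | m] - g) P :=
    stronglyMeasurable_condExp.aestronglyMeasurable.sub hgm
  have hfi : Integrable f P := hf.integrable one_le_two
  have huv : Integrable (fun ω => ⟪(P[f | m] - g) ω, (f - P[f | m]) ω⟫) P :=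
    (hv.norm.integrable_mul hu.norm).mono' (hv.1.inner hu.1)
      (ae_of_all _ fun ω => norm_inner_le_norm _ _)
  have hzero : P[f - P[f | m] | m] =ᵐ[P] 0 := by
    refine (condExp_sub hfi integrable_condExp m).trans ?_
    rw [condExp_of_stronglyMeasurable hm stronglyMeasurable_condExp integrable_condExp, sub_self]
  have horth : ∫ ω, ⟪(P[f | m] - g) ω, (f - P[f | m]) ω⟫ ∂P = 0 := by
    rw [← integral_condExp hm]
    refine integral_eq_zero_of_ae ?_
    filter_upwards [condExp_bilin_of_aestronglyMeasurable_left (innerSL ℝ) hvm huv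
      (hu.integrable one_le_two), hzero] with ω h₁ h₂
    refine h₁.trans ?_
    simp [h₂]
  have hu2 := hu.integrable_norm_pow two_ne_zero
  have hv2 := hv.integrable_norm_pow two_ne_zero
  calc ∫ ω, ‖f ω - (P[f | m]) ω‖ ^ 2 ∂P
      ≤ ∫ ω, ‖f ω - (P[f | m]) ω‖ ^ 2 ∂P + ∫ ω, ‖(P[f | m] - g) ω‖ ^ 2 ∂P :=
        le_add_of_nonneg_right (integral_nonneg fun ω => by positivity)
    _ = ∫ ω, (‖(f - P[f | m]) ω‖ ^ 2 + ‖(P[f | m] - g) ω‖ ^ 2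
          + 2 * ⟪(P[f | m] - g) ω, (f - P[f | m]) ω⟫) ∂P := by
        have h := integral_add (hu2.add hv2) (huv.const_mul 2)
        rw [integral_const_mul, horth, mul_zero, add_zero] at h
        exact (integral_add hu2 hv2).symm.trans h.symm
    _ = ∫ ω, ‖f ω - g ω‖ ^ 2 ∂P := by
        refine integral_congr_ae (ae_of_all _ fun ω => ?_)
        have h : f ω - g ω = (P[f | m] - g) ω + (f - P[f | m]) ω := by simp
        simp only [h, norm_add_sq_real]
        ring

theorem measurable_apply_label {ι α β : Type*} [MeasurableSpace α] [MeasurableSpace β]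
    [MeasurableSpace ι] [Countable ι] [MeasurableSingletonClass ι] {T : ι → α → β}
    (hT : ∀ i, Measurable (T i)) {X : Ω → α} {Y : Ω → ι} (hX : Measurable X)
    (hY : Measurable Y) : Measurable fun ω => T (Y ω) (X ω) :=
  (measurable_from_prod_countable_right (f := fun p : ι × α => T p.1 p.2) hT).comp
    (hY.prodMk hX)

/-- A randomly selected affine image of a square-integrable vector is square-integrable. -/
theorem memLp_two_affine_label {ι : Type*} [Finite ι] [MeasurableSpace ι]
    [MeasurableSingletonClass ι] [MeasurableSpace E] [BorelSpace E] [MeasurableSpace F]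
    [BorelSpace F] [SecondCountableTopology F] [IsFiniteMeasure P]
    (L : ι → E →L[ℝ] F) (c : ι → F) {X : Ω → E} (hX : Measurable X) (hX2 : MemLp X 2 P)
    {Y : Ω → ι} (hY : Measurable Y) : MemLp (fun ω => L (Y ω) (X ω) - c (Y ω)) 2 P := by
  have hmeas : Measurable fun ω => L (Y ω) (X ω) - c (Y ω) :=
    measurable_apply_label (T := fun i x => L i x - c i)
      (fun i => ((L i).continuous.sub continuous_const).measurable) hX hY
  have := Fintype.ofFinite ι
  have hsum : MemLp (fun ω => ∑ i, (‖L i‖ * ‖X ω‖ + ‖c i‖)) 2 P :=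
    memLp_finsetSum _ fun i _ => (hX2.norm.const_mul _).add (memLp_const _)
  refine hsum.mono hmeas.aestronglyMeasurable (ae_of_all _ fun ω => ?_)
  calc ‖L (Y ω) (X ω) - c (Y ω)‖ ≤ ‖L (Y ω)‖ * ‖X ω‖ + ‖c (Y ω)‖ :=
        (norm_sub_le _ _).trans (add_le_add_left ((L (Y ω)).le_opNorm _) _)
    _ ≤ ∑ i, (‖L i‖ * ‖X ω‖ + ‖c i‖) :=
        Finset.single_le_sum (f := fun i => ‖L i‖ * ‖X ω‖ + ‖c i‖)
          (fun i _ => by positivity) (Finset.mem_univ _)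
    _ ≤ _ := Real.le_norm_self _

/-- The squared distance between two members of a finite family of affine maps. -/
theorem norm_affine_sub_affine_sq_le {ι : Type*} [Finite ι] (L : ι → E →L[ℝ] F) (c : ι → F)
    (x : E) (i j : ι) :
    ‖(L i x - c i) - (L j x - c j)‖ ^ 2 ≤
      8 * (⨆ i, ‖L i‖ ^ 2) * ‖x‖ ^ 2 + 8 * ⨆ i, ‖c i‖ ^ 2 := by
  have hG (i : ι) : ‖L i x‖ ^ 2 ≤ (⨆ i, ‖L i‖ ^ 2) * ‖x‖ ^ 2 := by
    calc ‖L i x‖ ^ 2 ≤ (‖L i‖ * ‖x‖) ^ 2 := by gcongr; exact (L i).le_opNorm x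
      _ = ‖L i‖ ^ 2 * ‖x‖ ^ 2 := mul_pow _ _ _
      _ ≤ _ := by
        gcongr
        exact le_ciSup (f := fun i => ‖L i‖ ^ 2) (Set.finite_range _).bddAbove i
  have hM (i : ι) : ‖c i‖ ^ 2 ≤ ⨆ i, ‖c i‖ ^ 2 :=
    le_ciSup (f := fun i => ‖c i‖ ^ 2) (Set.finite_range _).bddAbove i
  have htri : ‖(L i x - c i) - (L j x - c j)‖ ≤ ‖L i x‖ + ‖c i‖ + (‖L j x‖ + ‖c j‖) :=
    (norm_sub_le _ _).trans (add_le_add (norm_sub_le _ _) (norm_sub_le _ _))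
  have hsq := pow_le_pow_left₀ (norm_nonneg _) htri 2
  nlinarith [hG i, hG j, hM i, hM j, sq_nonneg (‖L i x‖ - ‖c i‖), sq_nonneg (‖L j x‖ - ‖c j‖),
    sq_nonneg (‖L i x‖ + ‖c i‖ - (‖L j x‖ + ‖c j‖))]

theorem integrable_norm_sq_of_pow_four {G : Type*} [NormedAddCommGroup G] [IsFiniteMeasure P]
    {X : Ω → G} (hX : AEStronglyMeasurable X P) (hX4 : Integrable (fun ω => ‖X ω‖ ^ 4) P) :
    Integrable (fun ω => ‖X ω‖ ^ 2) P := by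
  refine ((integrable_const 1).add hX4).mono' (hX.norm.pow 2) (ae_of_all _ fun ω => ?_)
  simp only [norm_pow, norm_norm, Pi.add_apply]
  nlinarith [sq_nonneg (‖X ω‖ ^ 2 - 1), sq_nonneg (‖X ω‖ ^ 2)]

/-- The Cauchy–Schwarz inequality for the second moment on an event. -/
theorem setIntegral_norm_sq_le_sqrt_mul_sqrt {G : Type*} [NormedAddCommGroup G] [IsFiniteMeasure P]
    {X : Ω → G} (hX : AEStronglyMeasurable X P) (hX4 : Integrable (fun ω => ‖X ω‖ ^ 4) P)
    (A : Set Ω) :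
    ∫ ω in A, ‖X ω‖ ^ 2 ∂P ≤ √(P.real A) * √(∫ ω, ‖X ω‖ ^ 4 ∂P) := by
  have hX2 : MemLp (fun ω => ‖X ω‖ ^ 2) 2 P :=
    (memLp_two_iff_integrable_sq (hX.norm.pow 2)).2 (by simpa [← pow_mul] using hX4)
  have h := integral_mul_le_Lp_mul_Lq_of_nonneg (μ := P.restrict A) Real.HolderConjugate.two_two
    (f := fun _ => 1) (g := fun ω => ‖X ω‖ ^ 2) (ae_of_all _ fun _ => zero_le_one)
    (ae_of_all _ fun ω => by positivity) (memLp_const _)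
    (by simpa using hX2.restrict A)
  simp only [one_mul, integral_const, smul_eq_mul, Real.rpow_two, one_pow, mul_one, ← pow_mul,
    ← Real.sqrt_eq_rpow, measureReal_restrict_apply_univ] at h
  refine h.trans ?_
  exact mul_le_mul_of_nonneg_left (Real.sqrt_le_sqrt <|
    setIntegral_le_integral hX4 (ae_of_all _ fun ω => by positivity)) (Real.sqrt_nonneg _)

/-- Mean square error caused by evaluating a family of affine maps at a wrong label. -/
theorem integral_norm_affine_label_sub_sq_le {ι : Type*} [Finite ι] [MeasurableSpace ι]
    [MeasurableSingletonClass ι] [IsFiniteMeasure P] (L : ι → E →L[ℝ] F) (c : ι → F)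
    {X : Ω → E} (hX : AEStronglyMeasurable X P) (hX4 : Integrable (fun ω => ‖X ω‖ ^ 4) P)
    {Y Z : Ω → ι} (hY : Measurable Y) (hZ : Measurable Z) :
    ∫ ω, ‖(L (Y ω) (X ω) - c (Y ω)) - (L (Z ω) (X ω) - c (Z ω))‖ ^ 2 ∂P ≤
      8 * √(P.real {ω | Z ω ≠ Y ω}) * (⨆ i, ‖L i‖ ^ 2) * √(∫ ω, ‖X ω‖ ^ 4 ∂P) +
        8 * P.real {ω | Z ω ≠ Y ω} * ⨆ i, ‖c i‖ ^ 2 := by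
  set A := {ω | Z ω ≠ Y ω} with hAdef
  have hA : MeasurableSet A := (measurableSet_eq_fun hZ hY).compl
  have hX2 := integrable_norm_sq_of_pow_four hX hX4
  have hint : Integrable (fun ω => 8 * (⨆ i, ‖L i‖ ^ 2) * ‖X ω‖ ^ 2 + 8 * ⨆ i, ‖c i‖ ^ 2) P :=
    (hX2.const_mul _).add (integrable_const _)
  have hG : 0 ≤ ⨆ i, ‖L i‖ ^ 2 := Real.iSup_nonneg fun i => by positivity
  calc ∫ ω, ‖(L (Y ω) (X ω) - c (Y ω)) - (L (Z ω) (X ω) - c (Z ω))‖ ^ 2 ∂P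
      ≤ ∫ ω, A.indicator
          (fun ω => 8 * (⨆ i, ‖L i‖ ^ 2) * ‖X ω‖ ^ 2 + 8 * ⨆ i, ‖c i‖ ^ 2) ω ∂P := by
        refine integral_mono_of_nonneg (ae_of_all _ fun ω => by positivity)
          (hint.indicator hA) (ae_of_all _ fun ω => ?_)
        by_cases h : ω ∈ A
        · simpa only [Set.indicator_of_mem h] using norm_affine_sub_affine_sq_le L c _ _ _
        · have hZY : Z ω = Y ω := by simpa [hAdef] using h
          simp [Set.indicator_of_notMem h, hZY]
    _ = 8 * (⨆ i, ‖L i‖ ^ 2) * ∫ ω in A, ‖X ω‖ ^ 2 ∂P + 8 * P.real A * ⨆ i, ‖c i‖ ^ 2 := by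
        rw [integral_indicator hA, integral_add (hX2.restrict.const_mul _) (integrable_const _),
          integral_const_mul, integral_const, measureReal_restrict_apply_univ, smul_eq_mul]
        ring
    _ ≤ 8 * (⨆ i, ‖L i‖ ^ 2) * (√(P.real A) * √(∫ ω, ‖X ω‖ ^ 4 ∂P))
          + 8 * P.real A * ⨆ i, ‖c i‖ ^ 2 := by
        gcongr
        exact setIntegral_norm_sq_le_sqrt_mul_sqrt hX hX4 A
    _ = _ := by ring

end AuxiliaryLemmas

/-- For a random vector `X` with finite fourth moment, a random label `Y`,
a classifier `f` with misclassification probability `P_e = P(f(X) ≠ Y)`, and the randomized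
transport `Ψ(x, i) = Γᵢ(x − μᵢ) + μ̃ᵢ`, we have
`E‖Ψ(X,Y) − E[Ψ(X,Y)|X]‖² ≤ E‖Ψ(X,Y) − Ψ(X,f(X))‖²
  ≤ 8√P_e (maxᵢ‖Γᵢ‖²) √(E‖X‖⁴) + 8 P_e maxᵢ‖Γᵢμᵢ − μ̃ᵢ‖²`. -/
theorem stmt13 {Ω : Type*} [MeasurableSpace Ω] (P : Measure Ω) [IsProbabilityMeasure P]
    (d k : ℕ) (hd : 0 < d) (hk : 0 < k)
    (X : Ω → EuclideanSpace ℝ (Fin d)) (hX : Measurable X)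
    (hX4 : Integrable (fun ω => ‖X ω‖ ^ 4) P)
    (Y : Ω → Fin k) (hY : Measurable Y)
    (f : EuclideanSpace ℝ (Fin d) → Fin k) (hf : Measurable f)
    (Γ : Fin k → Matrix (Fin d) (Fin d) ℝ)
    (μ μt : Fin k → EuclideanSpace ℝ (Fin d))
    (Ψ : EuclideanSpace ℝ (Fin d) → Fin k → EuclideanSpace ℝ (Fin d))
    (hΨ : Ψ = fun x i => Matrix.toEuclideanLin (Γ i) (x - μ i) + μt i)
    (Pe : ℝ) (hPe : Pe = (P {ω | f (X ω) ≠ Y ω}).toReal) :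
    (∫ ω, ‖Ψ (X ω) (Y ω) -
        (P[(fun ω' => Ψ (X ω') (Y ω')) | MeasurableSpace.comap X inferInstance]) ω‖ ^ 2 ∂P ≤
      ∫ ω, ‖Ψ (X ω) (Y ω) - Ψ (X ω) (f (X ω))‖ ^ 2 ∂P) ∧
    ∫ ω, ‖Ψ (X ω) (Y ω) - Ψ (X ω) (f (X ω))‖ ^ 2 ∂P ≤
      8 * Real.sqrt Pe * (⨆ i, ‖Matrix.toEuclideanCLM (𝕜 := ℝ) (Γ i)‖ ^ 2) *
          Real.sqrt (∫ ω, ‖X ω‖ ^ 4 ∂P) +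
        8 * Pe * ⨆ i, ‖Matrix.toEuclideanLin (Γ i) (μ i) - μt i‖ ^ 2 := by
  have hX2 : MemLp X 2 P := (memLp_two_iff_integrable_sq_norm hX.aestronglyMeasurable).2
    (integrable_norm_sq_of_pow_four hX.aestronglyMeasurable hX4)
  let L (i : Fin k) : EuclideanSpace ℝ (Fin d) →L[ℝ] EuclideanSpace ℝ (Fin d) :=
    Matrix.toEuclideanCLM (𝕜 := ℝ) (Γ i)
  let c (i : Fin k) : EuclideanSpace ℝ (Fin d) := Matrix.toEuclideanLin (Γ i) (μ i) - μt i
  have hPsi : Ψ = fun x i => L i x - c i := by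
    rw [hΨ]
    funext x i
    have hL : L i x = Matrix.toEuclideanLin (Γ i) x := rfl
    rw [hL, map_sub]
    simp only [c]
    abel
  have hY2 := memLp_two_affine_label L c hX hX2 hY
  have hf2 := memLp_two_affine_label L c hX hX2 (hf.comp hX)
  have hXm : Measurable[MeasurableSpace.comap X inferInstance] X := comap_measurable X
  have hfm := measurable_apply_label (T := fun i x => L i x - c i)
    (fun i => ((L i).continuous.sub continuous_const).measurable) hXm (hf.comp hXm)
  have hmin := integral_norm_sub_condExp_sq_le hX.comap_le hY2 hf2 hfm.aestronglyMeasurable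
  have hbound := integral_norm_affine_label_sub_sq_le L c hX.aestronglyMeasurable hX4 hY
    (hf.comp hX)
  rw [hPsi, hPe]
  exact ⟨hmin, hbound⟩
end
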